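/- arXiv:2103.15077 — 7 statements merged into one kernel-verified Lean document; each statement's English description precedes it below -/
import Mathlib

section
/- Let f be a meromorphic function on the tube domain 𝒯_B that is distinguished with respect to (V; c; l_1, …, l_m), and let C be a connected component of B \ ∪_{j=1}^m ker(l_j). Then for every z in the tube domain 𝒯_C the integral defining f̃_C(z) = (2π)^{−ν} ∫_V f(z + iv) dv converges, and the function f̃_C : 𝒯_C → ℂ is holomorphic. -/
/-!
Setup: `E = ℝ^n`, `E_ℂ = ℂ^n`; linearly independent real linear forms
`l_1, …, l_m` on `E` given by their coefficient vectors `l j : Fin n → ℝ`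
(extended ℂ-linearly); a subspace `V ⊆ E` of dimension `ν` with a Lebesgue
measure, realized as the range of an injective linear map
`ι : ℝ^ν → ℝ^n` carrying the standard Lebesgue measure of `ℝ^ν`; an open
convex neighborhood `B` of `0` with `l_j > -1` on `B`; tube domains,
sufficient functions, distinguished functions, and
`f̃_C(z) = (2π)^{-ν} ∫_V f(z+iv) dv`.
-/

open MeasureTheory Filter
open scoped BigOperators

/-- The real linear form on `ℝ^n` with coefficient vector `a`. -/
noncomputable def lR {n : ℕ} (a : Fin n → ℝ) (x : Fin n → ℝ) : ℝ :=
  ∑ k, a k * x k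

/-- The ℂ-linear extension to `ℂ^n` of the real linear form with coefficient
vector `a`. -/
noncomputable def lC {n : ℕ} (a : Fin n → ℝ) (z : Fin n → ℂ) : ℂ :=
  ∑ k, (a k : ℂ) * z k

/-- The tube domain over a set `B ⊆ ℝ^n`: all `z ∈ ℂ^n` with `Re z ∈ B`. -/
def tube {n : ℕ} (B : Set (Fin n → ℝ)) : Set (Fin n → ℂ) :=
  {z | (fun k => (z k).re) ∈ B}

/-- `z + i·x`, for `z ∈ ℂ^n` and `x ∈ ℝ^n`. -/
noncomputable def addI {n : ℕ} (z : Fin n → ℂ) (x : Fin n → ℝ) : Fin n → ℂ :=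
  fun k => z k + Complex.I * (x k : ℂ)

/-- A *sufficient* function on `V` (in the fixed coordinates `V ≅ ℝ^ν`):
for every subspace `U ⊆ V` (realized as the range of an injective linear map
`u : ℝ^k → ℝ^ν`, carrying a Lebesgue measure) and every `v`, the function
`u ↦ c(v+u)` is measurable with finite integral `c_U(v)`, and for `v ∉ U`,
`c_U(τ v) → 0` as `τ → ±∞`. -/
def Sufficient {ν : ℕ} (c : (Fin ν → ℝ) → ℝ) : Prop :=
  ∀ (k : ℕ) (u : (Fin k → ℝ) →ₗ[ℝ] (Fin ν → ℝ)), Function.Injective u →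
    (∀ v : Fin ν → ℝ, Measurable (fun w : Fin k → ℝ => c (v + u w)) ∧
      Integrable (fun w : Fin k → ℝ => c (v + u w))) ∧
    (∀ v : Fin ν → ℝ, v ∉ LinearMap.range u →
      Tendsto (fun τ : ℝ => ∫ w : Fin k → ℝ, c (τ • v + u w)) atTop (nhds 0) ∧
      Tendsto (fun τ : ℝ => ∫ w : Fin k → ℝ, c (τ • v + u w)) atBot (nhds 0))

/-- `f` is a meromorphic function on the tube domain `𝒯_B` which is
*distinguished* with respect to `(V; c; l_1, …, l_m)`, with associated
holomorphic function `g(z) = f(z) ∏_j l_j(z)/(l_j(z)+1)` on `𝒯_B`.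
Here `V = range ι` with its Lebesgue measure. -/
structure Distinguished {n ν m : ℕ} (f g : (Fin n → ℂ) → ℂ)
    (B : Set (Fin n → ℝ)) (l : Fin m → (Fin n → ℝ))
    (ι : (Fin ν → ℝ) →ₗ[ℝ] (Fin n → ℝ)) (c : (Fin ν → ℝ) → ℝ) : Prop where
  hB_open : IsOpen B
  hB_convex : Convex ℝ B
  hB_zero : (0 : Fin n → ℝ) ∈ B
  hB_l : ∀ x ∈ B, ∀ j, -1 < lR (l j) x
  hl_indep : LinearIndependent ℝ l
  hι_inj : Function.Injective ι
  hg_holo : DifferentiableOn ℂ g (tube B)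
  hfg : ∀ z ∈ tube B, (∀ j, lC (l j) z ≠ 0) →
    g z = f z * ∏ j, lC (l j) z / (lC (l j) z + 1)
  hc_nonneg : ∀ v, 0 ≤ c v
  hc_suff : Sufficient c
  hbound : ∀ K : Set (Fin n → ℂ), K ⊆ tube B → IsCompact K →
    ∃ κ > (0 : ℝ), ∀ z ∈ K, ∀ v : Fin ν → ℝ, ‖g (addI z (ι v))‖ ≤ κ * c v

/-- `f̃(z) = (2π)^{-ν} ∫_V f(z + iv) dv`, where `V = range ι` with the
Lebesgue measure transported from `ℝ^ν`. -/
noncomputable def ftil {n ν : ℕ} (f : (Fin n → ℂ) → ℂ)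
    (ι : (Fin ν → ℝ) →ₗ[ℝ] (Fin n → ℝ)) (z : Fin n → ℂ) : ℂ :=
  ((2 * Real.pi : ℂ) ^ ν)⁻¹ * ∫ v : Fin ν → ℝ, f (addI z (ι v))

lemma lC_cont {n : ℕ} (a : Fin n → ℝ) : Differentiable ℂ (lC a) := by
  unfold lC; fun_prop

lemma lC_re {n : ℕ} (a : Fin n → ℝ) (z : Fin n → ℂ) :
    (lC a z).re = lR a (fun k => (z k).re) := by
  simp [lC, lR]

lemma addI_re {n : ℕ} (z : Fin n → ℂ) (x : Fin n → ℝ) :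
    (fun k => (addI z x k).re) = (fun k => (z k).re) := by
  funext k; simp [addI]

lemma addI_tube {n : ℕ} {S : Set (Fin n → ℝ)} {z : Fin n → ℂ} (x : Fin n → ℝ)
    (h : z ∈ tube S) : addI z x ∈ tube S := by
  simp only [tube, Set.mem_ofPred_eq] at h ⊢
  rw [addI_re]; exact h

lemma tube_open {n : ℕ} {S : Set (Fin n → ℝ)} (h : IsOpen S) : IsOpen (tube S) :=
  h.preimage (f := fun (z : Fin n → ℂ) => (fun k => (z k).re)) (by fun_prop)

lemma key {n ν m : ℕ} (f g : (Fin n → ℂ) → ℂ)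
    (B : Set (Fin n → ℝ)) (l : Fin m → (Fin n → ℝ))
    (ι : (Fin ν → ℝ) →ₗ[ℝ] (Fin n → ℝ)) (c : (Fin ν → ℝ) → ℝ)
    (hd : Distinguished f g B l ι c) (z₀ : Fin n → ℂ)
    (hz₀ : z₀ ∈ tube (B \ ⋃ j, {x | lR (l j) x = 0})) :
    Integrable (fun v : Fin ν → ℝ => f (addI z₀ (ι v))) ∧
    DifferentiableAt ℂ (ftil f ι) z₀ := by
  set S := B \ ⋃ j, {x | lR (l j) x = 0} with hS
  have hSo : IsOpen S := by
    refine hd.hB_open.sdiff (isClosed_iUnion_of_finite fun j => ?_)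
    refine isClosed_eq ?_ continuous_const
    unfold lR; fun_prop
  have hTo : IsOpen (tube S) := tube_open hSo
  have hTB : tube S ⊆ tube B := fun z hz => hz.1
  have hre : ∀ z ∈ tube S, ∀ j, lR (l j) (fun k => (z k).re) ≠ 0 := by
    intro z hz j h0
    exact hz.2 (Set.mem_iUnion.2 ⟨j, h0⟩)
  have hne : ∀ z ∈ tube S, ∀ j, lC (l j) z ≠ 0 := by
    intro z hz j h0
    apply hre z hz j
    rw [← lC_re, h0]; rfl
  have hne1 : ∀ z ∈ tube S, ∀ j, lC (l j) z + 1 ≠ 0 := by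
    intro z hz j h0
    have h1 := hd.hB_l _ (hTB hz) j
    rw [← lC_re] at h1
    have h2 := congrArg Complex.re h0
    simp at h2
    linarith
  have hf : ∀ z ∈ tube S, f z = g z * ∏ j, (1 + (lC (l j) z)⁻¹) := by
    intro z hz
    rw [hd.hfg z (hTB hz) (hne z hz), mul_assoc, ← Finset.prod_mul_distrib]
    rw [Finset.prod_eq_one, mul_one]
    intro j _
    have := hne z hz j
    have := hne1 z hz j
    field_simp
  have hfd : DifferentiableOn ℂ f (tube S) := by
    refine DifferentiableOn.congr ?_ hf
    refine (hd.hg_holo.mono hTB).mul ?_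
    have hj : ∀ j ∈ (Finset.univ : Finset (Fin m)),
        DifferentiableOn ℂ (fun z => 1 + (lC (l j) z)⁻¹) (tube S) := fun j _ =>
      ((lC_cont (l j)).differentiableOn.inv (fun z hz => hne z hz j)).const_add 1
    exact fun z hz => (HasFDerivWithinAt.finsetProd
      fun j hu => (hj j hu z hz).hasFDerivWithinAt).differentiableWithinAt
  obtain ⟨r, hr, hball⟩ := Metric.nhds_basis_closedBall.mem_iff.1 (hTo.mem_nhds hz₀)
  have hK : IsCompact (Metric.closedBall z₀ r) := isCompact_closedBall _ _
  obtain ⟨κ, hκ, hκb⟩ := hd.hbound _ (hball.trans hTB) hK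
  have hcont : ContinuousOn
      (fun z : Fin n → ℂ => ∏ j, (1 + |lR (l j) (fun k => (z k).re)|⁻¹))
      (Metric.closedBall z₀ r) := by
    refine continuousOn_finsetProd _ fun j _ => ?_
    refine continuousOn_const.add (ContinuousOn.inv₀ ?_ ?_)
    · unfold lR; fun_prop
    · intro z hz
      exact abs_ne_zero.2 (hre z (hball hz) j)
  obtain ⟨M, hM⟩ := (hK.image_of_continuousOn hcont).bddAbove
  have hfb : ∀ z ∈ Metric.closedBall z₀ r, ∀ v, ‖f (addI z (ι v))‖ ≤ κ * c v * M := by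
    intro z hz v
    have hzt := addI_tube (ι v) (hball hz)
    rw [hf _ hzt, norm_mul, norm_prod]
    refine mul_le_mul (hκb z hz v) ?_ (Finset.prod_nonneg fun _ _ => norm_nonneg _)
      (mul_nonneg hκ.le (hd.hc_nonneg v))
    refine le_trans ?_ (hM (Set.mem_image_of_mem _ hz))
    refine Finset.prod_le_prod (fun _ _ => norm_nonneg _) fun j _ => ?_
    refine (norm_add_le _ _).trans ?_
    rw [norm_one, norm_inv]
    have hp : 0 < |lR (l j) (fun k => (z k).re)| := abs_pos.2 (hre z (hball hz) j)
    gcongr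
    rw [← addI_re z (ι v), ← lC_re]
    exact Complex.abs_re_le_norm _
  have hci : Integrable c := by
    have := ((hd.hc_suff ν LinearMap.id Function.injective_id).1 0).2
    simpa using this
  have hιc : Continuous ι := ι.continuous_of_finiteDimensional
  have haddc : ∀ z, Continuous fun v => addI z (ι v) := by
    intro z; unfold addI; fun_prop
  have hmeas : ∀ z ∈ tube S, AEStronglyMeasurable (fun v : Fin ν → ℝ => f (addI z (ι v)))
      volume := by
    intro z hz
    exact (hfd.continuousOn.comp_continuous (haddc z)
      (fun v => addI_tube _ hz)).aestronglyMeasurable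
  have hint : Integrable (fun v : Fin ν → ℝ => f (addI z₀ (ι v))) := by
    refine Integrable.mono' ((hci.const_mul κ).mul_const M) (hmeas z₀ hz₀) ?_
    exact .of_forall fun v => hfb z₀ (Metric.mem_closedBall_self hr.le) v
  refine ⟨hint, ?_⟩
  have hder : ∀ z ∈ tube S, ∀ v, HasFDerivAt (fun z => f (addI z (ι v)))
      (fderiv ℂ f (addI z (ι v))) z := by
    intro z hz v
    have h1 : HasFDerivAt f (fderiv ℂ f (addI z (ι v))) (addI z (ι v)) :=
      (hfd.differentiableAt (hTo.mem_nhds (addI_tube _ hz))).hasFDerivAt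
    have h2 : HasFDerivAt (fun z => addI z (ι v)) (ContinuousLinearMap.id ℂ (Fin n → ℂ)) z :=
      (hasFDerivAt_id z).add_const (fun k => Complex.I * ((ι v k : ℝ) : ℂ))
    have h3 := h1.comp z h2
    rw [ContinuousLinearMap.comp_id] at h3
    exact h3
  have main := (hasFDerivAt_integral_of_dominated_loc_of_lip'
    (μ := (volume : Measure (Fin ν → ℝ)))
    (F := fun (z : Fin n → ℂ) (v : Fin ν → ℝ) => f (addI z (ι v)))
    (F' := fun v => fderiv ℂ f (addI z₀ (ι v)))
    (bound := fun v => 2 * (κ * c v * M) / r)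
    (Metric.ball_mem_nhds z₀ hr)
    (fun z hz => hmeas z (hball (Metric.ball_subset_closedBall hz)))
    hint
    (((measurable_fderiv ℂ f).comp (haddc z₀).measurable).aestronglyMeasurable)
    (.of_forall fun v z hz => ?_)
    ((((hci.const_mul κ).mul_const M).const_mul 2).div_const r)
    (.of_forall fun v => hder z₀ hz₀ v)).2
  · exact main.differentiableAt.const_mul _
  · have := Complex.dist_le_div_mul_dist_of_mapsTo_ball (f := fun z => f (addI z (ι v)))
      (c := z₀) (z := z) (R₁ := r) (R₂ := 2 * (κ * c v * M))
      (fun w hw => (hder w (hball (Metric.ball_subset_closedBall hw))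
        v).differentiableAt.differentiableWithinAt) ?_ hz
    · simpa [dist_eq_norm] using this
    · intro w hw
      rw [mem_closedBall_iff_norm]
      refine (norm_sub_le _ _).trans ?_
      have h1 := hfb w (Metric.ball_subset_closedBall hw) v
      have h2 := hfb z₀ (Metric.mem_closedBall_self hr.le) v
      linarith

theorem statement1 {n ν m : ℕ} (f g : (Fin n → ℂ) → ℂ)
    (B : Set (Fin n → ℝ)) (l : Fin m → (Fin n → ℝ))
    (ι : (Fin ν → ℝ) →ₗ[ℝ] (Fin n → ℝ)) (c : (Fin ν → ℝ) → ℝ)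
    (hdist : Distinguished f g B l ι c)
    -- `C` is a connected component of `B \ ∪_j ker l_j`
    (C : Set (Fin n → ℝ))
    (hC : ∃ x₀ ∈ B \ ⋃ j, {x | lR (l j) x = 0},
      C = connectedComponentIn (B \ ⋃ j, {x | lR (l j) x = 0}) x₀) :
    -- the integral defining `f̃_C` converges on `𝒯_C` ...
    (∀ z ∈ tube C, Integrable (fun v : Fin ν → ℝ => f (addI z (ι v)))) ∧
    -- ... and `f̃_C` is holomorphic on `𝒯_C`
    DifferentiableOn ℂ (ftil f ι) (tube C) := by
  obtain ⟨x₀, _, rfl⟩ := hC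
  have hsub : ∀ z ∈ tube (connectedComponentIn (B \ ⋃ j, {x | lR (l j) x = 0}) x₀),
      z ∈ tube (B \ ⋃ j, {x | lR (l j) x = 0}) :=
    fun z hz => connectedComponentIn_subset (B \ ⋃ j, {x | lR (l j) x = 0}) x₀ hz
  exact ⟨fun z hz => (key f g B l ι c hdist z (hsub z hz)).1,
    fun z hz => (key f g B l ι c hdist z (hsub z hz)).2.differentiableWithinAt⟩
end

section
/- Let f be a meromorphic function on 𝒯_B distinguished with respect to (V; c; l_1, …, l_m), with g(z) = f(z) ∏_{j=1}^m l_j(z)/(l_j(z)+1) its associated holomorphic function on 𝒯_B, and let C be a connected component of B \ ∪_{j=1}^m ker(l_j). Set E^{(0)} = ∩_{j=1}^m ker(l_j) and E_0 = E/E^{(0)}, and assume V ∩ E^{(0)} = {0}. Let π_0 : E → E_0 be the projection, E_0^+ = {x ∈ E_0 : l_j(x) ≥ 0 for 1 ≤ j ≤ m} (the forms l_j descend to E_0), and assume π_0(V) ∩ E_0^+ = {0}. Let P = E_0/π_0(V) with canonical projection ψ_0 : E_0 → P, so that Λ = ψ_0(E_0^+) is a strictly convex polyhedral cone in P. Normalize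 measures as follows: dy is the Lebesgue measure on E_0^∨ normalized by the lattice ⊕_{j=1}^m ℤ l_j; A ⊂ V is a lattice of full rank, dv is the Lebesgue measure on V normalized by A, dy' is the Lebesgue measure on V^∨ normalized by the dual lattice A^∨, and dy'' is the measure on P^∨ obtained from a section of the projection E_0^∨ → V^∨ so that dy = dy' dy''. Define the 𝒳-function of Λ by 𝒳_Λ(x) = ∫_{Λ^∨} e^{−y''(x)} dy'' for x ∈ P_ℂ with Re x in the interior of Λ, where Λ^∨ ⊂ P^∨ is the dual cone of Λ. Let B^+ = B ∩ {x ∈ E : l_j(x) > 0 for all j}. Then for every x_0 ∈ B^+, with f̃_C(z) = (2π)^{−ν} ∫_V f(z+iv) dv one has lim_{s → 0^+} s^{m−ν} f̃_C(s x_0) = g(0) · 𝒳_Λ(ψ_0(π_0(x_0))). -/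
/-!
Setup: `E = ℝ^n`, `E_ℂ = ℂ^n`; linearly independent real linear forms
`l_1, …, l_m` on `E` given by their coefficient vectors `l j : Fin n → ℝ`
(extended ℂ-linearly); a subspace `V ⊆ E` of dimension `ν` with a Lebesgue
measure, realized as the range of an injective linear map
`ι : ℝ^ν → ℝ^n` carrying the standard Lebesgue measure of `ℝ^ν`; an open
convex neighborhood `B` of `0` with `l_j > -1` on `B`; tube domains,
sufficient functions, distinguished functions, and
`f̃_C(z) = (2π)^{-ν} ∫_V f(z+iv) dv`.
-/

open MeasureTheory Filter
open scoped BigOperators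

namespace S3

/-- The map to `ℝ^ν` given by a selection of the forms. -/
noncomputable def Tb {ν m : ℕ} (φ : Fin m → ((Fin ν → ℝ) →ₗ[ℝ] ℝ)) (b : Fin ν → Fin m) :
    (Fin ν → ℝ) →ₗ[ℝ] (Fin ν → ℝ) := LinearMap.pi (fun i => φ (b i))

theorem Tb_apply {ν m : ℕ} (φ : Fin m → ((Fin ν → ℝ) →ₗ[ℝ] ℝ)) (b : Fin ν → Fin m) (v : Fin ν → ℝ)
    (i : Fin ν) : Tb φ b v i = φ (b i) v := rfl

theorem exists_good {ν m : ℕ} (φ : Fin m → ((Fin ν → ℝ) →ₗ[ℝ] ℝ))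
    (h0 : ∀ v, (∀ j, φ j v = 0) → v = 0) :
    ∃ b : Fin ν → Fin m, Function.Injective (Tb φ b) := by
  let S : Submodule ℝ (Module.Dual ℝ (Fin ν → ℝ)) := Submodule.span ℝ (Set.range φ)
  have hS : S = ⊤ := by
    have h1 : S.dualCoannihilator = ⊥ := by
      rw [eq_bot_iff]
      intro v hv
      rw [Submodule.mem_dualCoannihilator] at hv
      exact h0 v (fun j => hv _ (Submodule.subset_span ⟨j, rfl⟩))
    have h2 : S.dualCoannihilator.dualAnnihilator = S := Subspace.dualCoannihilator_dualAnnihilator_eq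
    rw [← h2, h1]; simp
  obtain ⟨f, hf, hspan, -⟩ := Submodule.exists_fun_fin_finrank_span_eq ℝ (Set.range φ)
  have hfr : Module.finrank ℝ (Submodule.span ℝ (Set.range φ)) = ν := by
    change Module.finrank ℝ S = ν
    rw [hS, finrank_top, Subspace.dual_finrank_eq]; simp
  choose b hb using hf
  refine ⟨fun i => b (Fin.cast hfr.symm i), ?_⟩
  rw [injective_iff_map_eq_zero]
  intro v hv
  apply h0
  intro j
  have hj : φ j ∈ Submodule.span ℝ (Set.range f) := by
    rw [hspan]; exact Submodule.subset_span ⟨j, rfl⟩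
  have key : ∀ ψ ∈ Submodule.span ℝ (Set.range f), ψ v = 0 := by
    intro ψ hψ
    induction hψ using Submodule.span_induction with
    | mem x hx =>
      obtain ⟨i, rfl⟩ := hx
      have := congrFun hv (Fin.cast hfr i)
      rw [Tb_apply] at this
      simpa [hb] using this
    | zero => rfl
    | add x y _ _ hx hy => simp [hx, hy]
    | smul a x _ hx => simp [hx]
  exact key _ hj

theorem good_inj {ν m : ℕ} (φ : Fin m → ((Fin ν → ℝ) →ₗ[ℝ] ℝ)) (b : Fin ν → Fin m)
    (hb : Function.Injective (Tb φ b)) : Function.Injective b := by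
  have hs := LinearMap.injective_iff_surjective.1 hb
  intro i i' h
  obtain ⟨v, hv⟩ := hs (Pi.single i 1)
  by_contra hne
  have h1 := congrFun hv i
  have h2 := congrFun hv i'
  rw [Tb_apply] at h1 h2
  rw [h] at h1
  rw [h1] at h2
  simp [Pi.single_eq_of_ne (Ne.symm hne)] at h2

theorem basis_lemma {ν m : ℕ} (hν : 0 < ν) (φ : Fin m → ((Fin ν → ℝ) →ₗ[ℝ] ℝ))
    (h0 : ∀ v, (∀ j, 0 ≤ φ j v) → v = 0) (w : Fin m → ℝ) :
    ∃ b : Fin ν → Fin m, Function.Injective (Tb φ b) ∧ ∃ j, (∀ i, b i ≠ j) ∧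
      ∀ i, w (b i) ≤ w j := by
  classical
  have : Nonempty (Fin ν) := ⟨⟨0, hν⟩⟩
  let S : Finset (Fin ν → Fin m) := Finset.univ.filter (fun b => Function.Injective (Tb φ b))
  have hS : S.Nonempty := by
    obtain ⟨b, hb⟩ := exists_good φ (fun v hv => h0 v (fun j => (hv j).ge))
    exact ⟨b, by simp [S, hb]⟩
  obtain ⟨b, hbS, hmin⟩ := S.exists_min_image (fun b => ∑ i, w (b i)) hS
  have hb : Function.Injective (Tb φ b) := by simpa [S] using hbS
  obtain ⟨i₀, -, hi₀⟩ := Finset.univ.exists_max_image (fun i => w (b i)) Finset.univ_nonempty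
  have hs := LinearMap.injective_iff_surjective.1 hb
  obtain ⟨u, hu⟩ := hs (Pi.single i₀ 1)
  have hu' : ∀ i, φ (b i) u = (Pi.single i₀ (1:ℝ) : Fin ν → ℝ) i := fun i => by
    rw [← hu, Tb_apply]
  have hu0 : u ≠ 0 := by
    rintro rfl
    have := hu' i₀
    simp at this
  have : ∃ j, φ j u < 0 := by
    by_contra hcon
    push Not at hcon
    exact hu0 (h0 u hcon)
  obtain ⟨j, hj⟩ := this
  refine ⟨b, hb, j, ?_, ?_⟩
  · rintro i rfl
    rw [hu' i] at hj
    by_cases h : i = i₀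
    · subst h; simp at hj; linarith
    · simp [h] at hj
  · let b' := Function.update b i₀ j
    have hb' : Function.Injective (Tb φ b') := by
      rw [injective_iff_map_eq_zero]
      intro v hv
      have hv' : ∀ i, φ (b' i) v = 0 := fun i => by rw [← Tb_apply, hv]; rfl
      have e : v = (φ (b i₀) v) • u := by
        apply hb
        ext i
        rw [map_smul, Pi.smul_apply, Tb_apply, Tb_apply, hu' i]
        by_cases h : i = i₀
        · subst h; simp
        · have := hv' i
          simp only [b', Function.update_of_ne h] at this
          simp [h, this]
      have h1 := hv' i₀
      simp only [b', Function.update_self] at h1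
      rw [e, map_smul, smul_eq_mul] at h1
      rcases mul_eq_zero.1 h1 with h2 | h2
      · rw [e, h2, zero_smul]
      · exact absurd h2 hj.ne
    have h1 := hmin b' (by simp [S, hb'])
    have h2 : ∑ i, w (b' i) = ∑ i, w (b i) - w (b i₀) + w j := by
      rw [← Finset.add_sum_erase _ _ (Finset.mem_univ i₀),
        ← Finset.add_sum_erase _ (fun i => w (b i)) (Finset.mem_univ i₀)]
      have : ∑ x ∈ Finset.univ.erase i₀, w (b' x) = ∑ x ∈ Finset.univ.erase i₀, w (b x) := by
        apply Finset.sum_congr rfl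
        intro x hx
        simp only [b', Function.update_of_ne (Finset.ne_of_mem_erase hx)]
      rw [this]
      simp only [b', Function.update_self]
      ring
    intro i
    have h3 := hi₀ i (Finset.mem_univ i)
    linarith


theorem det_ne {ν : ℕ} {T : (Fin ν → ℝ) →ₗ[ℝ] (Fin ν → ℝ)} (hT : Function.Injective T) :
    LinearMap.det T ≠ 0 := by
  have : IsUnit T := (Module.End.isUnit_iff T).2 ⟨hT, LinearMap.injective_iff_surjective.1 hT⟩
  exact (this.map LinearMap.det).ne_zero

theorem integrable_comp_T {ν : ℕ} {T : (Fin ν → ℝ) →ₗ[ℝ] (Fin ν → ℝ)} (hT : Function.Injective T)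
    {F : (Fin ν → ℝ) → ℝ} (hF : Integrable F) : Integrable (fun v => F (T v)) := by
  have h := Measure.map_linearMap_addHaar_eq_smul_addHaar (volume : Measure (Fin ν → ℝ)) (det_ne hT)
  have hc : Measurable T := T.continuous_of_finiteDimensional.measurable
  have h2 : Integrable F (Measure.map T volume) := by
    rw [h]; exact hF.smul_measure ENNReal.ofReal_ne_top
  exact h2.comp_measurable hc

theorem lintegral_comp_T {ν : ℕ} {T : (Fin ν → ℝ) →ₗ[ℝ] (Fin ν → ℝ)} (hT : Function.Injective T)
    {F : (Fin ν → ℝ) → ENNReal} (hF : Measurable F) :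
    ∫⁻ v, F (T v) = ENNReal.ofReal |(LinearMap.det T)⁻¹| * ∫⁻ v, F v := by
  have h := Measure.map_linearMap_addHaar_eq_smul_addHaar (volume : Measure (Fin ν → ℝ)) (det_ne hT)
  have hc : Measurable T := T.continuous_of_finiteDimensional.measurable
  rw [← lintegral_map hF hc, h, lintegral_smul_measure, smul_eq_mul]

theorem prod_split {ν m : ℕ} (b : Fin ν → Fin m) (hb : Function.Injective b) (j : Fin m)
    (hj : ∀ i, b i ≠ j) (x : Fin m → ℝ) :
    ∏ k, x k = (∏ i, x (b i)) * x j *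
      ∏ k ∈ Finset.univ \ (insert j (Finset.univ.image b)), x k := by
  classical
  rw [← Finset.prod_sdiff (Finset.subset_univ (insert j (Finset.univ.image b))), mul_comm]
  congr 1
  rw [Finset.prod_insert, Finset.prod_image (fun a _ c _ h => hb h), mul_comm]
  simpa using hj

theorem card_split {ν m : ℕ} (b : Fin ν → Fin m) (hb : Function.Injective b) (j : Fin m)
    (hj : ∀ i, b i ≠ j) :
    (Finset.univ \ (insert j (Finset.univ.image b))).card + (ν + 1) = m := by
  classical
  have h1 : (insert j (Finset.univ.image b)).card = ν + 1 := by
    rw [Finset.card_insert_of_notMem (by simpa using hj), Finset.card_image_of_injective _ hb]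
    simp
  have h2 := Finset.card_sdiff_add_card_eq_card (Finset.subset_univ (insert j (Finset.univ.image b)))
  rw [h1] at h2
  simpa using h2

theorem integrable_zero_dim (F : (Fin 0 → ℝ) → ℝ) : Integrable F := by
  have : IsFiniteMeasure (volume : Measure (Fin 0 → ℝ)) := by
    constructor
    rw [volume_pi, Measure.pi_of_empty]
    simp
  exact Integrable.of_finite

theorem integrable_dom {ν m : ℕ} (φ : Fin m → ((Fin ν → ℝ) →ₗ[ℝ] ℝ))
    (h0 : ∀ v, (∀ j, 0 ≤ φ j v) → v = 0) :
    Integrable (fun u : Fin ν → ℝ => ∏ j, (1 + |φ j u|)⁻¹) := by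
  classical
  have hcont : Continuous (fun u : Fin ν → ℝ => ∏ j, (1 + |φ j u|)⁻¹) := by
    apply continuous_finsetProd
    intro j _
    have := (φ j).continuous_of_finiteDimensional
    exact Continuous.inv₀ (by fun_prop) (fun u => by positivity)
  rcases Nat.eq_zero_or_pos ν with rfl | hν
  · exact integrable_zero_dim _
  obtain ⟨p, hpd⟩ : ∃ p : ℝ, p = 1 + 1 / ν := ⟨_, rfl⟩
  have hp : 1 < p := by rw [hpd]; simp; positivity
  obtain ⟨S, hS⟩ : ∃ S : Finset (Fin ν → Fin m), ∀ b, b ∈ S ↔ Function.Injective (Tb φ b) :=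
    ⟨Finset.univ.filter (fun b => Function.Injective (Tb φ b)), fun b => by simp⟩
  have hone : Integrable (fun t : ℝ => (1 + |t|) ^ (-p)) := by
    have := integrable_one_add_norm (E := ℝ) (μ := volume) (r := p) (by simpa using hp)
    simpa using this
  have hb : ∀ b ∈ S, Integrable (fun u : Fin ν → ℝ => ∏ i, (1 + |φ (b i) u|) ^ (-p)) := by
    intro b hb
    have hb' : Function.Injective (Tb φ b) := (hS b).1 hb
    have h1 : Integrable (fun x : Fin ν → ℝ => ∏ i, (1 + |x i|) ^ (-p)) :=
      Integrable.fintype_prod (fun _ => hone)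
    exact integrable_comp_T hb' h1
  have hsum : Integrable (fun u : Fin ν → ℝ => ∑ b ∈ S, ∏ i, (1 + |φ (b i) u|) ^ (-p)) :=
    integrable_finsetSum S hb
  refine hsum.mono' hcont.aestronglyMeasurable (Eventually.of_forall ?_)
  intro u
  rw [Real.norm_of_nonneg (Finset.prod_nonneg (fun j _ => by positivity))]
  obtain ⟨b, hbi, j, hj, hw⟩ := basis_lemma hν φ h0 (fun j => |φ j u|)
  have hbS : b ∈ S := (hS b).2 hbi
  have hle : ∏ i, (1 + |φ (b i) u|) ^ (-p) ≤ ∑ b ∈ S, ∏ i, (1 + |φ (b i) u|) ^ (-p) :=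
    Finset.single_le_sum (f := fun b : Fin ν → Fin m => ∏ i, (1 + |φ (b i) u|) ^ (-p))
      (fun b _ => Finset.prod_nonneg (fun i _ => by positivity)) hbS
  refine le_trans ?_ hle
  rw [prod_split b (good_inj φ b hbi) j hj]
  have h1 : ∏ k ∈ Finset.univ \ (insert j (Finset.univ.image b)), (1 + |φ k u|)⁻¹ ≤ 1 := by
    apply Finset.prod_le_one
    · intro i _; positivity
    · intro i _; apply inv_le_one_of_one_le₀; linarith [abs_nonneg (φ i u)]
  have h2 : (1 + |φ j u|)⁻¹ ≤ ∏ i : Fin ν, (1 + |φ (b i) u|) ^ (-(1 / (ν:ℝ))) := by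
    have hνr : (0:ℝ) < ν := by exact_mod_cast hν
    have e : (1 + |φ j u|)⁻¹ = ∏ i : Fin ν, (1 + |φ j u|) ^ (-(1 / (ν:ℝ))) := by
      rw [Finset.prod_const, Finset.card_univ, Fintype.card_fin, ← Real.rpow_natCast,
        ← Real.rpow_mul (by positivity)]
      rw [show -(1 / (ν:ℝ)) * ν = -1 by field_simp, Real.rpow_neg_one]
    rw [e]
    apply Finset.prod_le_prod
    · intro i _; positivity
    · intro i _
      apply Real.rpow_le_rpow_of_nonpos (by positivity) (by linarith [hw i])
      simp
  calc (∏ i, (1 + |φ (b i) u|)⁻¹) * (1 + |φ j u|)⁻¹ *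
        ∏ k ∈ Finset.univ \ (insert j (Finset.univ.image b)), (1 + |φ k u|)⁻¹
      ≤ (∏ i, (1 + |φ (b i) u|)⁻¹) * (∏ i : Fin ν, (1 + |φ (b i) u|) ^ (-(1 / (ν:ℝ)))) * 1 := by
        gcongr
    _ = ∏ i, (1 + |φ (b i) u|) ^ (-p) := by
        rw [mul_one, ← Finset.prod_mul_distrib]
        apply Finset.prod_congr rfl
        intro i _
        rw [← Real.rpow_neg_one, ← Real.rpow_add (by positivity)]
        congr 1
        rw [hpd]; ring

theorem integrable_k (p : ℝ) (hp : p < 1) :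
    Integrable ((Set.Icc (-1:ℝ) 1).indicator (fun t : ℝ => |t| ^ (-p))) := by
  rw [integrable_indicator_iff measurableSet_Icc]
  have h1 : IntegrableOn (fun t : ℝ => |t| ^ (-p)) (Set.Ioc 0 1) := by
    have h := intervalIntegral.intervalIntegrable_rpow' (a := 0) (b := 1) (r := -p) (by linarith)
    rw [intervalIntegrable_iff_integrableOn_Ioc_of_le zero_le_one] at h
    refine h.congr_fun (fun t ht => ?_) measurableSet_Ioc
    simp only [abs_of_pos ht.1]
  have h2 : IntegrableOn (fun t : ℝ => |t| ^ (-p)) (Set.Ico (-1) 0) := by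
    have := h1.comp_neg
    simpa using this
  have : Set.Icc (-1:ℝ) 1 = Set.Ico (-1) 0 ∪ ({0} ∪ Set.Ioc 0 1) := by
    ext t; simp only [Set.mem_Icc, Set.mem_union, Set.mem_Ico, Set.mem_Ioc, Set.mem_singleton_iff]
    constructor
    · rintro ⟨h, h'⟩
      rcases lt_trichotomy t 0 with h3 | h3 | h3
      · exact Or.inl ⟨h, h3⟩
      · exact Or.inr (Or.inl h3)
      · exact Or.inr (Or.inr ⟨h3, h'⟩)
    · rintro (⟨h, h'⟩ | h | ⟨h, h'⟩) <;> constructor <;> linarith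
  rw [this]
  refine h2.union (IntegrableOn.union ?_ h1)
  exact integrableOn_singleton (hx := by simp)

theorem locint {ν : ℕ} (p : ℝ) (hp0 : 0 ≤ p) (hp : p < 1) {T : (Fin ν → ℝ) →ₗ[ℝ] (Fin ν → ℝ)}
    (hT : Function.Injective T) :
    ∃ M : ENNReal, M ≠ ⊤ ∧ ∀ s : Fin ν → ℝ,
      ∫⁻ v in Metric.closedBall s 1, ENNReal.ofReal (∏ i, (1 + |T v i| ^ (-p))) ≤ M := by
  let Tc : (Fin ν → ℝ) →L[ℝ] (Fin ν → ℝ) := LinearMap.toContinuousLinearMap T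
  let R : ℝ := ‖Tc‖
  let k : ℝ → ℝ := (Set.Icc (-1:ℝ) 1).indicator (fun t : ℝ => |t| ^ (-p))
  have hk : Integrable k := integrable_k p hp
  have hk0 : ∀ t, 0 ≤ k t := fun t => Set.indicator_nonneg (fun t _ => by positivity) t
  let I : ℝ → ℝ → ℝ := fun s => (Metric.closedBall s R).indicator (fun _ => 2)
  have hI : ∀ s, Integrable (I s) := fun s => by
    rw [integrable_indicator_iff measurableSet_closedBall]
    exact integrableOn_const measure_closedBall_lt_top.ne
  let q : ℝ → ℝ → ℝ := fun s t => I s t + k t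
  have hq : ∀ s, Integrable (q s) := fun s => (hI s).add hk
  have hI0 : ∀ s t, 0 ≤ I s t := fun s t => Set.indicator_nonneg (fun t _ => by positivity) t
  have hqint : ∀ s, ∫ t, q s t = 4 * R + ∫ t, k t := by
    intro s
    rw [integral_add (hI s) hk]
    congr 1
    simp only [I]
    rw [integral_indicator measurableSet_closedBall, setIntegral_const]
    simp [Measure.real, Real.volume_closedBall, R]
    ring
  have hkm : Measurable k := by
    refine Measurable.indicator ?_ measurableSet_Icc
    fun_prop
  have hIm : ∀ s, Measurable (I s) := fun s =>
    Measurable.indicator measurable_const measurableSet_closedBall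
  refine ⟨ENNReal.ofReal |(LinearMap.det T)⁻¹| * ENNReal.ofReal ((4 * R + ∫ t, k t) ^ ν),
    ENNReal.mul_ne_top ENNReal.ofReal_ne_top ENNReal.ofReal_ne_top, ?_⟩
  intro s
  have e : ENNReal.ofReal ((4 * R + ∫ t, k t) ^ ν) =
      ∫⁻ x : Fin ν → ℝ, ENNReal.ofReal (∏ i, q (T s i) (x i)) := by
    rw [← ofReal_integral_eq_lintegral_ofReal]
    · rw [integral_fintype_prod_volume_eq_prod (fun i => q (T s i))]
      simp [hqint]
    · exact Integrable.fintype_prod (fun i => hq _)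
    · exact Eventually.of_forall (fun x => Finset.prod_nonneg
        (fun i _ => add_nonneg (hI0 _ _) (hk0 _)))
  rw [e, ← lintegral_comp_T hT, ← lintegral_indicator measurableSet_closedBall]
  · apply lintegral_mono
    intro v
    by_cases hv : v ∈ Metric.closedBall s 1
    · rw [Set.indicator_of_mem hv]
      apply ENNReal.ofReal_le_ofReal
      apply Finset.prod_le_prod
      · intro i _; positivity
      · intro i _
        have h1 : T v i ∈ Metric.closedBall (T s i) R := by
          rw [Metric.mem_closedBall, dist_eq_norm]
          rw [Metric.mem_closedBall, dist_eq_norm] at hv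
          calc ‖T v i - T s i‖ = ‖(Tc (v - s)) i‖ := by simp [Tc]
            _ ≤ ‖Tc (v - s)‖ := norm_le_pi_norm _ i
            _ ≤ ‖Tc‖ * ‖v - s‖ := Tc.le_opNorm _
            _ ≤ R := by
              have := norm_nonneg Tc
              simp only [R]; nlinarith
        simp only [q, I]
        rw [Set.indicator_of_mem h1]
        by_cases h2 : T v i ∈ Set.Icc (-1:ℝ) 1
        · simp only [k]; rw [Set.indicator_of_mem h2]; linarith
        · have h3 : |T v i| ^ (-p) ≤ 1 := by
            have : 1 ≤ |T v i| := by
              by_contra hcon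
              push Not at hcon
              have := abs_lt.1 hcon
              exact h2 ⟨this.1.le, this.2.le⟩
            exact Real.rpow_le_one_of_one_le_of_nonpos this (by linarith)
          have := hk0 (T v i)
          linarith
    · rw [Set.indicator_of_notMem hv]; simp
  · apply ENNReal.measurable_ofReal.comp
    apply Finset.measurable_prod
    intro i _
    exact ((hIm _).add hkm).comp (measurable_pi_apply i)

theorem tonelli_bound {ν : ℕ} (G c Ψ : (Fin ν → ℝ) → ENNReal) (hc : Measurable c)
    (hΨ : Measurable Ψ) (M : ENNReal)
    (hG : ∀ v s, dist v s ≤ 1 → G v ≤ c s)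
    (hM : ∀ s, ∫⁻ v in Metric.closedBall s 1, Ψ v ≤ M) :
    ∫⁻ v, G v * Ψ v ≤ (volume (Metric.closedBall (0 : Fin ν → ℝ) 1))⁻¹ * (M * ∫⁻ s, c s) := by
  set W := volume (Metric.closedBall (0 : Fin ν → ℝ) 1)
  have hW0 : W ≠ 0 := (Metric.measure_closedBall_pos _ _ one_pos).ne'
  have hWt : W ≠ ⊤ := measure_closedBall_lt_top.ne
  have hset : MeasurableSet {q : (Fin ν → ℝ) × (Fin ν → ℝ) | dist q.1 q.2 ≤ 1} :=
    (isClosed_le (by fun_prop) (by fun_prop)).measurableSet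
  have h1 : ∀ v, G v ≤ W⁻¹ * ∫⁻ s in Metric.closedBall v 1, c s := by
    intro v
    have : W * G v ≤ ∫⁻ s in Metric.closedBall v 1, c s := by
      calc W * G v = ∫⁻ s in Metric.closedBall v 1, G v := by
            rw [setLIntegral_const, mul_comm]
            congr 1
            exact (Measure.addHaar_closedBall_center volume v 1).symm
        _ ≤ _ := by
            apply setLIntegral_mono hc
            intro s hs
            apply hG
            rw [dist_comm]; exact hs
    calc G v = W⁻¹ * (W * G v) := by
          rw [← mul_assoc, ENNReal.inv_mul_cancel hW0 hWt, one_mul]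
      _ ≤ _ := by gcongr
  let F : (Fin ν → ℝ) → (Fin ν → ℝ) → ENNReal := fun v s =>
    {q : (Fin ν → ℝ) × (Fin ν → ℝ) | dist q.1 q.2 ≤ 1}.indicator (fun q => c q.2 * Ψ q.1) (v, s)
  have hF : Measurable (Function.uncurry F) := by
    refine Measurable.indicator ?_ hset
    exact (hc.comp measurable_snd).mul (hΨ.comp measurable_fst)
  calc ∫⁻ v, G v * Ψ v ≤ ∫⁻ v, W⁻¹ * ∫⁻ s, F v s := by
        apply lintegral_mono
        intro v
        calc G v * Ψ v ≤ (W⁻¹ * ∫⁻ s in Metric.closedBall v 1, c s) * Ψ v := by gcongr; exact h1 v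
          _ = W⁻¹ * ∫⁻ s, F v s := by
            rw [mul_assoc, ← lintegral_mul_const _ hc, ← lintegral_indicator measurableSet_closedBall]
            congr 2
            ext s
            simp only [F, Set.indicator, Metric.mem_closedBall, Set.mem_ofPred_eq, dist_comm s v]
    _ = W⁻¹ * ∫⁻ v, ∫⁻ s, F v s := lintegral_const_mul' _ _ (ENNReal.inv_ne_top.2 hW0)
    _ = W⁻¹ * ∫⁻ s, ∫⁻ v, F v s := by rw [lintegral_lintegral_swap hF.aemeasurable]
    _ ≤ W⁻¹ * ∫⁻ s, M * c s := by
        gcongr with s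
        calc ∫⁻ v, F v s = c s * ∫⁻ v in Metric.closedBall s 1, Ψ v := by
              rw [← lintegral_indicator measurableSet_closedBall, ← lintegral_const_mul _
                (hΨ.indicator measurableSet_closedBall)]
              congr 1
              ext v
              simp only [F, Set.indicator, Metric.mem_closedBall, Set.mem_ofPred_eq]
              split_ifs <;> simp
          _ ≤ M * c s := by rw [mul_comm]; gcongr; exact hM s
    _ = _ := by rw [lintegral_const_mul _ hc]


theorem scalar_bound {σ μ a t ε p : ℝ} (hσ : 0 < σ) (hσ1 : σ ≤ 1) (hμ : 0 < μ) (hμ1 : μ ≤ 1)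
    (hμa : μ ≤ a) (ht : t ≠ 0) (hε : 0 ≤ ε) (hε1 : ε ≤ 1) (hp : p = 1 - ε) :
    σ ^ ε * (1 + 1 / max (σ * a) |t|) ≤ (1 + 1 / μ) * (1 + |t| ^ (-p)) := by
  have ht' : 0 < |t| := abs_pos.2 ht
  set x := max (σ * a) |t| with hx
  have hx0 : 0 < x := lt_of_lt_of_le ht' (le_max_right _ _)
  have h1 : x = x ^ ε * x ^ p := by
    rw [← Real.rpow_add hx0, hp]; simp
  have h2 : (σ * μ) ^ ε * |t| ^ p ≤ x := by
    conv_rhs => rw [h1]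
    have : σ * μ ≤ x := le_trans (by gcongr) (le_max_left _ _)
    have h3 : |t| ≤ x := le_max_right _ _
    gcongr
    linarith
  have h4 : σ ^ ε * (1 / x) ≤ 1 / μ * |t| ^ (-p) := by
    rw [Real.mul_rpow hσ.le hμ.le] at h2
    have h5 : μ ≤ μ ^ ε := by
      conv_lhs => rw [← Real.rpow_one μ]
      exact Real.rpow_le_rpow_of_exponent_ge hμ hμ1 hε1
    have h6 : 0 < σ ^ ε := Real.rpow_pos_of_pos hσ _
    have h7 : 0 < |t| ^ p := Real.rpow_pos_of_pos ht' _
    rw [Real.rpow_neg ht'.le, mul_one_div, one_div, ← mul_inv, ← one_div, div_le_div_iff₀ hx0 (by positivity)]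
    rw [one_mul]
    refine le_trans ?_ h2
    rw [mul_assoc]
    gcongr
  have h8 : σ ^ ε ≤ 1 := Real.rpow_le_one hσ.le hσ1 hε
  have h9 : 0 ≤ |t| ^ (-p) := by positivity
  have h10 : 0 < 1 / μ := by positivity
  nlinarith

theorem ae_ne {ν m : ℕ} (φ : Fin m → ((Fin ν → ℝ) →ₗ[ℝ] ℝ)) :
    ∀ᵐ v : Fin ν → ℝ, ∀ j, φ j ≠ 0 → φ j v ≠ 0 := by
  rw [ae_all_iff]
  intro j
  by_cases h : φ j = 0
  · exact Eventually.of_forall (fun v hv => absurd h hv)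
  · have : volume ((LinearMap.ker (φ j) : Submodule ℝ (Fin ν → ℝ)) : Set (Fin ν → ℝ)) = 0 := by
      apply Measure.addHaar_submodule
      intro hk
      exact h (LinearMap.ker_eq_top.1 hk)
    rw [ae_iff]
    refine measure_mono_null ?_ this
    intro v hv
    simp at hv
    simpa using hv.2

theorem far_bound {ν m : ℕ} (φ : Fin m → ((Fin ν → ℝ) →ₗ[ℝ] ℝ))
    (h0 : ∀ v, (∀ j, 0 ≤ φ j v) → v = 0) (a : Fin m → ℝ) (ha : ∀ j, 0 < a j)
    (c : (Fin ν → ℝ) → ℝ) (hc0 : ∀ v, 0 ≤ c v) (hcm : Measurable c) (hci : Integrable c)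
    (κ : ℝ) (hκ : 0 < κ) :
    ∃ D : ENNReal, D ≠ ⊤ ∧ ∀ σ : ℝ, 0 < σ → σ ≤ 1 → ∀ G : (Fin ν → ℝ) → ℝ, Measurable G →
      (∀ v, 0 ≤ G v) → (∀ v s, dist v s ≤ 1 → G v ≤ κ * c s) →
      ∫⁻ v in (Metric.closedBall (0 : Fin ν → ℝ) 1)ᶜ,
        ENNReal.ofReal (σ ^ (m - ν) * (G v * ∏ j, (1 + 1 / max (σ * a j) |φ j v|))) ≤
      D * ENNReal.ofReal (σ ^ (1 / ((ν : ℝ) + 1))) := by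
  rcases Nat.eq_zero_or_pos ν with h | hν
  · refine ⟨0, ENNReal.zero_ne_top, ?_⟩
    intro σ _ _ G _ _ _
    have : (Metric.closedBall (0 : Fin ν → ℝ) 1)ᶜ = ∅ := by
      subst h
      rw [Set.compl_empty_iff, Set.eq_univ_iff_forall]
      intro v
      rw [Subsingleton.elim v 0]
      simp
    rw [this]; simp
  obtain ⟨ε, hε⟩ : ∃ ε : ℝ, ε = 1 / ((ν : ℝ) + 1) := ⟨_, rfl⟩
  have hνr : (0:ℝ) < ν := by exact_mod_cast hν
  have hε0 : 0 < ε := by rw [hε]; positivity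
  have hε1 : ε ≤ 1 := by rw [hε, div_le_one (by positivity)]; linarith
  have hεm : ε * (ν + 1) = 1 := by rw [hε]; field_simp
  rw [← hε]
  obtain ⟨S, hS⟩ : ∃ S : Finset (Fin ν → Fin m), ∀ b, b ∈ S ↔ Function.Injective (Tb φ b) := by
    classical
    exact ⟨Finset.univ.filter (fun b => Function.Injective (Tb φ b)), fun b => by simp⟩
  obtain ⟨μ, hμ, hμ1, hμa⟩ : ∃ μ : ℝ, 0 < μ ∧ μ ≤ 1 ∧ ∀ j, μ ≤ a j := by
    rcases isEmpty_or_nonempty (Fin m) with hm | hm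
    · exact ⟨1, one_pos, le_rfl, fun j => (hm.false j).elim⟩
    · obtain ⟨j, hj⟩ := Finite.exists_min a
      exact ⟨min 1 (a j), lt_min one_pos (ha j), min_le_left _ _,
        fun k => (min_le_right _ _).trans (hj k)⟩
  obtain ⟨C, hC⟩ : ∃ C : ℝ, C = 1 + 1 / μ := ⟨_, rfl⟩
  have hC1 : 1 ≤ C := by rw [hC]; have : 0 < 1 / μ := by positivity
                         linarith
  have hδ : ∀ b : Fin ν → Fin m, ∃ δ : ℝ, 0 < δ ∧ (b ∈ S → ∀ v, δ * ‖v‖ ≤ ‖Tb φ b v‖) := by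
    intro b
    by_cases hb : b ∈ S
    · obtain ⟨K, hK, hanti⟩ := LinearMap.exists_antilipschitzWith (Tb φ b)
        (LinearMap.ker_eq_bot.2 ((hS b).1 hb))
      refine ⟨(K:ℝ)⁻¹, by positivity, fun _ v => ?_⟩
      have := hanti.le_mul_dist v 0
      simp only [dist_zero_right, map_zero] at this
      rw [inv_mul_le_iff₀ (by positivity)]
      exact this
    · exact ⟨1, one_pos, fun h => absurd h hb⟩
  choose δ hδ0 hδ using hδ
  have hM : ∀ b : Fin ν → Fin m, ∃ M : ENNReal, M ≠ ⊤ ∧ (b ∈ S → ∀ s : Fin ν → ℝ,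
      ∫⁻ v in Metric.closedBall s 1, ENNReal.ofReal (∏ i, (1 + |Tb φ b v i| ^ (-(1 - ε)))) ≤ M) := by
    intro b
    by_cases hb : b ∈ S
    · obtain ⟨M, h1, h2⟩ := locint (1 - ε) (by linarith) (by linarith) ((hS b).1 hb)
      exact ⟨M, h1, fun _ => h2⟩
    · exact ⟨0, ENNReal.zero_ne_top, fun h => absurd h hb⟩
  choose M hMt hM using hM
  let W := volume (Metric.closedBall (0 : Fin ν → ℝ) 1)
  have hW0 : W ≠ 0 := (Metric.measure_closedBall_pos _ _ one_pos).ne'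
  let Db : (Fin ν → Fin m) → ℝ := fun b => C ^ ν * (1 + 1 / δ b) * C ^ m
  have hcf : ∫⁻ s, ENNReal.ofReal (κ * c s) ≠ ⊤ := by
    have := (hci.const_mul κ).lintegral_lt_top
    exact this.ne
  refine ⟨∑ b ∈ S, ENNReal.ofReal (Db b) * (W⁻¹ * (M b * ∫⁻ s, ENNReal.ofReal (κ * c s))), ?_, ?_⟩
  · rw [ENNReal.sum_ne_top]
    intro b _
    exact ENNReal.mul_ne_top ENNReal.ofReal_ne_top (ENNReal.mul_ne_top (ENNReal.inv_ne_top.2 hW0)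
      (ENNReal.mul_ne_top (hMt b) hcf))
  intro σ hσ hσ1 G hGm hG0 hG
  have hΨm : ∀ b, Measurable (fun v : Fin ν → ℝ =>
      ENNReal.ofReal (∏ i, (1 + |Tb φ b v i| ^ (-(1 - ε))))) := by
    intro b
    apply ENNReal.measurable_ofReal.comp
    apply Finset.measurable_prod
    intro i _
    have : Measurable (fun v : Fin ν → ℝ => Tb φ b v i) :=
      (φ (b i)).continuous_of_finiteDimensional.measurable
    fun_prop
  have hterm : ∀ b ∈ S, ∫⁻ v, ENNReal.ofReal (G v) *
      ENNReal.ofReal (∏ i, (1 + |Tb φ b v i| ^ (-(1 - ε)))) ≤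
      W⁻¹ * (M b * ∫⁻ s, ENNReal.ofReal (κ * c s)) := by
    intro b hb
    apply tonelli_bound _ _ _ (by fun_prop) (hΨm b) (M b) _ (hM b hb)
    intro v s hvs
    exact ENNReal.ofReal_le_ofReal (hG v s hvs)
  have hpt : ∀ᵐ v : Fin ν → ℝ, v ∈ (Metric.closedBall (0 : Fin ν → ℝ) 1)ᶜ →
      ENNReal.ofReal (σ ^ (m - ν) * (G v * ∏ j, (1 + 1 / max (σ * a j) |φ j v|))) ≤
      ∑ b ∈ S, ENNReal.ofReal (σ ^ ε) * (ENNReal.ofReal (Db b) * (ENNReal.ofReal (G v) *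
      ENNReal.ofReal (∏ i, (1 + |Tb φ b v i| ^ (-(1 - ε)))))) := by
    filter_upwards [ae_ne φ] with v hv hvb
    have hv1 : 1 < ‖v‖ := by simpa using hvb
    obtain ⟨b, hbi, j, hj, hw⟩ := basis_lemma hν φ h0 (fun j => |φ j v|)
    have hbS : b ∈ S := (hS b).2 hbi
    refine le_trans ?_ (Finset.single_le_sum (f := fun b => ENNReal.ofReal (σ ^ ε) *
      (ENNReal.ofReal (Db b) * (ENNReal.ofReal (G v) *
      ENNReal.ofReal (∏ i, (1 + |Tb φ b v i| ^ (-(1 - ε))))))) (fun b _ => zero_le) hbS)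
    have hDb0 : 0 ≤ Db b := by
      have := hδ0 b
      simp only [Db]; positivity
    rw [← ENNReal.ofReal_mul (hG0 v), ← ENNReal.ofReal_mul hDb0,
      ← ENNReal.ofReal_mul (by positivity)]
    apply ENNReal.ofReal_le_ofReal
    have hxpos : ∀ k, 0 < max (σ * a k) |φ k v| := fun k =>
      lt_of_lt_of_le (mul_pos hσ (ha k)) (le_max_left _ _)
    have hcard := card_split b (good_inj φ b hbi) j hj
    set R := Finset.univ \ (insert j (Finset.univ.image b)) with hR
    have hsig : σ ^ (m - ν) = σ ^ ε * (∏ i : Fin ν, σ ^ ε) * ∏ k ∈ R, σ := by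
      have e1 : m - ν = R.card + 1 := by omega
      have e2 : σ ^ ε * (σ ^ ε) ^ ν = σ := by
        rw [← pow_succ', ← Real.rpow_natCast, ← Real.rpow_mul hσ.le]
        push_cast
        rw [hεm, Real.rpow_one]
      rw [e1, pow_succ', Finset.prod_const, Finset.prod_const, Finset.card_univ, Fintype.card_fin, e2]
    have hδj : δ b ≤ |φ j v| := by
      obtain ⟨i, hi⟩ : ∃ i, δ b ≤ |Tb φ b v i| := by
        by_contra hcon
        push Not at hcon
        have h1 := hδ b hbS v
        have h2 : ‖Tb φ b v‖ < δ b := by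
          rw [pi_norm_lt_iff (hδ0 b)]
          exact hcon
        have := hδ0 b
        nlinarith
      exact hi.trans (hw i)
    have f1 : ∏ i : Fin ν, (σ ^ ε * (1 + 1 / max (σ * a (b i)) |φ (b i) v|)) ≤
        C ^ ν * ∏ i, (1 + |Tb φ b v i| ^ (-(1 - ε))) := by
      have : C ^ ν * ∏ i, (1 + |Tb φ b v i| ^ (-(1 - ε))) =
          ∏ i : Fin ν, (C * (1 + |Tb φ b v i| ^ (-(1 - ε)))) := by
        rw [Finset.prod_mul_distrib]; simp
      rw [this]
      apply Finset.prod_le_prod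
      · intro i _
        have := hxpos (b i)
        positivity
      · intro i _
        rw [hC]
        apply scalar_bound hσ hσ1 hμ hμ1 (hμa _) _ hε0.le hε1 rfl
        apply hv
        intro hzero
        obtain ⟨u, hu⟩ := LinearMap.injective_iff_surjective.1 hbi (Pi.single i 1)
        have := congrFun hu i
        rw [Tb_apply, hzero] at this
        simp at this
    have f2 : 1 + 1 / max (σ * a j) |φ j v| ≤ 1 + 1 / δ b := by
      have := hδ0 b
      have h3 : δ b ≤ max (σ * a j) |φ j v| := hδj.trans (le_max_right _ _)
      gcongr
    have f3 : ∏ k ∈ R, (σ * (1 + 1 / max (σ * a k) |φ k v|)) ≤ C ^ m := by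
      calc ∏ k ∈ R, (σ * (1 + 1 / max (σ * a k) |φ k v|)) ≤ ∏ k ∈ R, C := by
            apply Finset.prod_le_prod
            · intro k _
              have := hxpos k
              positivity
            · intro k _
              have h3 : σ * μ ≤ max (σ * a k) |φ k v| :=
                le_trans (mul_le_mul_of_nonneg_left (hμa k) hσ.le) (le_max_left _ _)
              have h4 : 1 / max (σ * a k) |φ k v| ≤ 1 / (σ * μ) := by gcongr
              calc σ * (1 + 1 / max (σ * a k) |φ k v|) ≤ σ * (1 + 1 / (σ * μ)) := by gcongr
                _ = σ + 1 / μ := by field_simp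
                _ ≤ C := by rw [hC]; linarith
        _ = C ^ R.card := by simp
        _ ≤ C ^ m := pow_le_pow_right₀ hC1 (by omega)
    have n1 : 0 ≤ ∏ i, (1 + |Tb φ b v i| ^ (-(1 - ε))) :=
      Finset.prod_nonneg (fun i _ => by positivity)
    have n2 : 0 ≤ ∏ i : Fin ν, (σ ^ ε * (1 + 1 / max (σ * a (b i)) |φ (b i) v|)) :=
      Finset.prod_nonneg (fun i _ => by have := hxpos (b i); positivity)
    have n3 : 0 ≤ ∏ k ∈ R, (σ * (1 + 1 / max (σ * a k) |φ k v|)) :=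
      Finset.prod_nonneg (fun k _ => by have := hxpos k; positivity)
    have n4 : 0 ≤ 1 + 1 / max (σ * a j) |φ j v| := by have := hxpos j; positivity
    have n5 := hδ0 b
    have n6 : 0 ≤ σ ^ ε := by positivity
    rw [prod_split b (good_inj φ b hbi) j hj (fun j => 1 + 1 / max (σ * a j) |φ j v|), hsig, ← hR]
    calc σ ^ ε * (∏ i : Fin ν, σ ^ ε) * (∏ k ∈ R, σ) * (G v *
          ((∏ i, (1 + 1 / max (σ * a (b i)) |φ (b i) v|)) * (1 + 1 / max (σ * a j) |φ j v|) *
          ∏ k ∈ R, (1 + 1 / max (σ * a k) |φ k v|)))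
        = σ ^ ε * G v * ((∏ i : Fin ν, (σ ^ ε * (1 + 1 / max (σ * a (b i)) |φ (b i) v|))) *
          (1 + 1 / max (σ * a j) |φ j v|) * ∏ k ∈ R, (σ * (1 + 1 / max (σ * a k) |φ k v|))) := by
          rw [Finset.prod_mul_distrib, Finset.prod_mul_distrib]; ring
      _ ≤ σ ^ ε * G v * ((C ^ ν * ∏ i, (1 + |Tb φ b v i| ^ (-(1 - ε)))) * (1 + 1 / δ b) * C ^ m) := by
          apply mul_le_mul_of_nonneg_left _ (mul_nonneg n6 (hG0 v))
          apply mul_le_mul _ f3 n3 (by positivity)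
          exact mul_le_mul f1 f2 n4 (by positivity)
      _ = σ ^ ε * (Db b * (G v * ∏ i, (1 + |Tb φ b v i| ^ (-(1 - ε))))) := by
          simp only [Db]; ring
  calc _ ≤ ∫⁻ v in (Metric.closedBall (0 : Fin ν → ℝ) 1)ᶜ,
        ∑ b ∈ S, ENNReal.ofReal (σ ^ ε) * (ENNReal.ofReal (Db b) * (ENNReal.ofReal (G v) *
      ENNReal.ofReal (∏ i, (1 + |Tb φ b v i| ^ (-(1 - ε)))))) :=
        lintegral_mono_ae ((ae_restrict_iff' measurableSet_closedBall.compl).2 hpt)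
    _ ≤ ∫⁻ v, ∑ b ∈ S, ENNReal.ofReal (σ ^ ε) * (ENNReal.ofReal (Db b) * (ENNReal.ofReal (G v) *
      ENNReal.ofReal (∏ i, (1 + |Tb φ b v i| ^ (-(1 - ε)))))) := setLIntegral_le_lintegral _ _
    _ ≤ _ := by
        have hmG : ∀ b, Measurable (fun v : Fin ν → ℝ => ENNReal.ofReal (G v) *
            ENNReal.ofReal (∏ i, (1 + |Tb φ b v i| ^ (-(1 - ε))))) := fun b =>
          (ENNReal.measurable_ofReal.comp hGm).mul (hΨm b)
        rw [lintegral_finsetSum _ (fun b _ => ((hmG b).const_mul _).const_mul _), Finset.sum_mul]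
        apply Finset.sum_le_sum
        intro b hb
        rw [lintegral_const_mul _ ((hmG b).const_mul _), lintegral_const_mul _ (hmG b), mul_comm]
        gcongr
        exact hterm b hb


theorem inv_zero {ν : ℕ} (F Q : (Fin ν → ℝ) → ℂ) (hF : Integrable F) (hQ : Integrable Q)
    (hFQ : ∀ u : Fin ν → ℝ,
      ∫ y : Fin ν → ℝ, Complex.exp (-(Complex.I * ((∑ t, y t * u t : ℝ) : ℂ))) * F y = Q u)
    (hc : ContinuousAt F 0) :
    ((2 * Real.pi : ℂ) ^ ν)⁻¹ * ∫ u, Q u = F 0 := by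
  have hvp := PiLp.volume_preserving_toLp (Fin ν)
  have hme := (MeasurableEquiv.toLp 2 (Fin ν → ℝ)).measurableEmbedding
  obtain ⟨F', hF'⟩ : ∃ F' : EuclideanSpace ℝ (Fin ν) → ℂ, F' = fun x => F (WithLp.ofLp x) :=
    ⟨_, rfl⟩
  have hF'i : Integrable F' := by
    rw [← hvp.integrable_comp_emb hme, hF']
    exact hF
  have hfour : ∀ w : EuclideanSpace ℝ (Fin ν),
      FourierTransform.fourier F' w = Q ((2 * Real.pi) • WithLp.ofLp w) := by
    intro w
    rw [Real.fourier_eq', ← hvp.integral_comp hme, ← hFQ]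
    congr 1
    ext y
    rw [hF']
    simp only [smul_eq_mul, PiLp.inner_apply, RCLike.inner_apply, conj_trivial, Pi.smul_apply]
    congr 2
    push_cast
    rw [Finset.mul_sum, Finset.mul_sum, Finset.sum_mul, ← Finset.sum_neg_distrib]
    refine Finset.sum_congr rfl (fun i _ => ?_)
    ring
  have hpi : (2 * Real.pi) ≠ 0 := by positivity
  have hfi : Integrable (FourierTransform.fourier F') := by
    rw [← hvp.integrable_comp_emb hme]
    have : (FourierTransform.fourier F' ∘ (WithLp.toLp 2 : (Fin ν → ℝ) → EuclideanSpace ℝ (Fin ν)))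
        = fun u => Q ((2 * Real.pi) • u) := by
      ext u
      simp [hfour]
    rw [this]
    exact hQ.comp_smul hpi
  have hcF : ContinuousAt F' 0 := by
    rw [hF']
    have : ContinuousAt (fun x : EuclideanSpace ℝ (Fin ν) => (WithLp.ofLp x : Fin ν → ℝ)) 0 :=
      (PiLp.continuous_ofLp 2 _).continuousAt
    exact ContinuousAt.comp (f := fun x : EuclideanSpace ℝ (Fin ν) => (WithLp.ofLp x : Fin ν → ℝ)) hc this
  have key := hF'i.fourierInv_fourier_eq hfi hcF
  rw [Real.fourierInv_eq', ← hvp.integral_comp hme] at key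
  simp only [hfour, inner_zero_right, mul_zero, Complex.ofReal_zero, zero_mul, Complex.exp_zero,
    one_smul] at key
  rw [Measure.integral_comp_smul] at key
  rw [hF'] at key
  simp only [Module.finrank_fintype_fun_eq_card, Fintype.card_fin] at key
  rw [abs_of_pos (by positivity)] at key
  have h2 : F 0 = F (WithLp.ofLp (0 : EuclideanSpace ℝ (Fin ν))) := rfl
  rw [h2, ← key, Complex.real_smul]
  push_cast
  rfl

theorem norm_ge_left (a x : ℝ) : |a| ≤ ‖(a : ℂ) + Complex.I * x‖ := by
  have := Complex.abs_re_le_norm ((a : ℂ) + Complex.I * x)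
  simpa using this

theorem norm_ge_right (a x : ℝ) : |x| ≤ ‖(a : ℂ) + Complex.I * x‖ := by
  have := Complex.abs_im_le_norm ((a : ℂ) + Complex.I * x)
  simpa using this

theorem ne_zero_of {a : ℝ} (ha : 0 < a) (x : ℝ) : (a : ℂ) + Complex.I * x ≠ 0 := by
  rw [← norm_pos_iff]
  exact lt_of_lt_of_le (abs_pos.2 ha.ne') (norm_ge_left a x)

theorem Q_cont {ν m : ℕ} (φ : Fin m → ((Fin ν → ℝ) →ₗ[ℝ] ℝ)) (a : Fin m → ℝ) (ha : ∀ j, 0 < a j) :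
    Continuous (fun u : Fin ν → ℝ => ∏ j, ((a j : ℂ) + Complex.I * (φ j u : ℝ))⁻¹) := by
  refine continuous_finsetProd _ (fun j _ => ?_)
  have : Continuous (φ j) := (φ j).continuous_of_finiteDimensional
  exact Continuous.inv₀ (by fun_prop) (fun u => ne_zero_of (ha j) _)

theorem Q_int {ν m : ℕ} (φ : Fin m → ((Fin ν → ℝ) →ₗ[ℝ] ℝ))
    (h0 : ∀ v, (∀ j, 0 ≤ φ j v) → v = 0) (a : Fin m → ℝ) (ha : ∀ j, 0 < a j) :
    Integrable (fun u : Fin ν → ℝ => ∏ j, ((a j : ℂ) + Complex.I * (φ j u : ℝ))⁻¹) := by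
  refine ((integrable_dom φ h0).const_mul (∏ j, (1 / a j + 1))).mono'
    (Q_cont φ a ha).aestronglyMeasurable (Eventually.of_forall (fun u => ?_))
  rw [norm_prod, ← Finset.prod_mul_distrib]
  refine Finset.prod_le_prod (fun j _ => norm_nonneg _) (fun j _ => ?_)
  rw [norm_inv]
  have h1 := norm_ge_left (a j) (φ j u)
  have h2 := norm_ge_right (a j) (φ j u)
  rw [abs_of_pos (ha j)] at h1
  have hN : 0 < ‖(a j : ℂ) + Complex.I * (φ j u : ℝ)‖ := lt_of_lt_of_le (ha j) h1
  generalize ‖(a j : ℂ) + Complex.I * (φ j u : ℝ)‖ = N at *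
  have ha' := ha j
  rw [← div_eq_mul_inv, inv_eq_one_div, div_le_div_iff₀ hN (by positivity)]
  have : 1 ≤ 1 / a j * N := by
    rw [one_div, inv_mul_eq_div, le_div_iff₀ ha']; linarith
  nlinarith

/-- One-sided exponential. -/
noncomputable def ps (a y : ℝ) : ℂ := Set.indicator (Set.Ici 0) (fun y : ℝ => Complex.exp (-(a : ℂ) * y)) y

theorem ps_meas (a : ℝ) : Measurable (ps a) := by
  unfold ps
  exact Measurable.indicator (by fun_prop) measurableSet_Ici

theorem ps_int {a : ℝ} (ha : 0 < a) : Integrable (ps a) := by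
  have h : IntegrableOn (fun y : ℝ => Complex.exp (-(a : ℂ) * y)) (Set.Ici 0) := by
    rw [integrableOn_Ici_iff_integrableOn_Ioi]
    exact integrableOn_exp_mul_complex_Ioi (by simpa using ha) 0
  exact h.integrable_indicator measurableSet_Ici

theorem ps_four {a : ℝ} (ha : 0 < a) (x : ℝ) :
    ∫ y : ℝ, ps a y * Complex.exp (-(Complex.I * ((y * x : ℝ) : ℂ))) =
      ((a : ℂ) + Complex.I * x)⁻¹ := by
  have : ∀ y : ℝ, ps a y * Complex.exp (-(Complex.I * ((y * x : ℝ) : ℂ))) =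
      Set.indicator (Set.Ici 0) (fun y : ℝ => Complex.exp (-((a : ℂ) + Complex.I * x) * y)) y := by
    intro y
    unfold ps
    by_cases hy : y ∈ Set.Ici (0 : ℝ)
    · rw [Set.indicator_of_mem hy, Set.indicator_of_mem hy, ← Complex.exp_add]
      congr 1
      push_cast
      ring
    · rw [Set.indicator_of_notMem hy, Set.indicator_of_notMem hy, zero_mul]
  simp_rw [this]
  rw [integral_indicator measurableSet_Ici, integral_Ici_eq_integral_Ioi,
    integral_exp_mul_complex_Ioi (by simpa using ha)]
  have := ne_zero_of ha x
  simp
  rw [neg_div, ← div_neg]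
  simp [add_comm]

theorem ps_norm (a y : ℝ) : ‖ps a y‖ = Set.indicator (Set.Ici 0) (fun y : ℝ => Real.exp (-a * y)) y := by
  unfold ps
  rw [Set.indicator_apply, Set.indicator_apply]
  split_ifs
  · rw [Complex.norm_exp]; simp
  · simp

theorem ps_norm_le {a : ℝ} (ha : 0 < a) (y : ℝ) : ‖ps a y‖ ≤ Real.exp (-(a * |y|)) := by
  rw [ps_norm, Set.indicator_apply]
  split_ifs with h
  · rw [abs_of_nonneg h, neg_mul]
  · positivity

theorem ps_contAt (a : ℝ) {y : ℝ} (hy : y ≠ 0) : ContinuousAt (ps a) y := by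
  rcases lt_or_gt_of_ne hy with h | h
  · have : ps a =ᶠ[nhds y] fun _ => 0 := by
      filter_upwards [gt_mem_nhds h] with z hz
      unfold ps
      rw [Set.indicator_of_notMem]
      simpa using hz
    exact continuousAt_const.congr this.symm
  · have : ps a =ᶠ[nhds y] fun z : ℝ => Complex.exp (-(a : ℂ) * z) := by
      filter_upwards [lt_mem_nhds h] with z hz
      unfold ps
      rw [Set.indicator_of_mem]
      exact hz.le
    exact ContinuousAt.congr (by fun_prop) this.symm

theorem exp_abs_int {a : ℝ} (ha : 0 < a) : Integrable (fun y : ℝ => Real.exp (-(a * |y|))) := by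
  have h1 : IntegrableOn (fun y : ℝ => Real.exp (-(a * |y|))) (Set.Ioi 0) := by
    refine (integrableOn_exp_mul_Ioi (neg_lt_zero.2 ha) 0).congr_fun ?_ measurableSet_Ioi
    intro y hy
    have hy' : (0 : ℝ) < y := hy
    simp [abs_of_pos hy']
  have h2 : IntegrableOn (fun y : ℝ => Real.exp (-(a * |y|))) (Set.Iic 0) := by
    refine (integrableOn_exp_mul_Iic ha 0).congr_fun ?_ measurableSet_Iic
    intro y hy
    have hy' : y ≤ 0 := hy
    simp [abs_of_nonpos hy']
  rw [← integrableOn_univ, ← Set.Iic_union_Ioi (a := (0 : ℝ))]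
  exact h2.union h1

theorem exp_dom {p m : ℕ} (a : Fin m → ℝ) (ha : ∀ j, 0 < a j) (κm : (Fin p → ℝ) →ₗ[ℝ] (Fin m → ℝ))
    (hinj : Function.Injective κm) :
    Integrable (fun w : Fin p → ℝ => ∏ j, Real.exp (-(a j * |κm w j|))) := by
  classical
  have hκc : Continuous κm := κm.continuous_of_finiteDimensional
  obtain ⟨b, hb⟩ := exists_good (fun j => (LinearMap.proj j).comp κm) (fun v hv => by
    apply hinj
    rw [map_zero]
    ext j
    exact hv j)
  have hbi := good_inj _ b hb
  have h1 : Integrable (fun x : Fin p → ℝ => ∏ i, Real.exp (-(a (b i) * |x i|))) :=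
    Integrable.fintype_prod (f := fun i (y : ℝ) => Real.exp (-(a (b i) * |y|)))
      (fun i => exp_abs_int (ha _))
  refine (integrable_comp_T hb h1).mono' ?_ (Eventually.of_forall (fun w => ?_))
  · apply Continuous.aestronglyMeasurable
    fun_prop
  · rw [Real.norm_of_nonneg (by positivity)]
    have h2 : ∏ i, Real.exp (-(a (b i) * |κm w (b i)|)) =
        ∏ j ∈ Finset.univ.image b, Real.exp (-(a j * |κm w j|)) := by
      rw [Finset.prod_image (fun a _ c _ h => hbi h)]
    change _ ≤ ∏ i, Real.exp (-(a (b i) * |κm w (b i)|))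
    rw [h2]
    rw [← Finset.prod_sdiff (Finset.subset_univ (Finset.univ.image b))]
    refine mul_le_of_le_one_left (by positivity) ?_
    refine Finset.prod_le_one (fun j _ => by positivity) (fun j _ => ?_)
    rw [Real.exp_le_one_iff]
    have := mul_nonneg (ha j).le (abs_nonneg (κm w j))
    linarith

theorem F0_cont {ν m p : ℕ} (φ : Fin m → ((Fin ν → ℝ) →ₗ[ℝ] ℝ))
    (h0 : ∀ v, (∀ j, 0 ≤ φ j v) → v = 0) (a : Fin m → ℝ) (ha : ∀ j, 0 < a j)
    (s : (Fin ν → ℝ) →ₗ[ℝ] (Fin m → ℝ))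
    (hs : ∀ (y' : Fin ν → ℝ) (t : Fin ν), (∑ j, s y' j * φ j (Pi.single t 1)) = y' t)
    (κm : (Fin p → ℝ) →ₗ[ℝ] (Fin m → ℝ))
    (hκm_inj : Function.Injective κm)
    (hκm_surj : ∀ y : Fin m → ℝ,
      (∀ t : Fin ν, (∑ j, y j * φ j (Pi.single t 1)) = 0) → ∃ w, κm w = y)
    (t : ℝ) :
    ContinuousAt (fun y' : Fin ν → ℝ => ∫ w : Fin p → ℝ, ∏ j, ps (a j) (s y' j + κm w j)
      ∂(ENNReal.ofReal t • volume)) 0 := by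
  classical
  have hsc : Continuous s := s.continuous_of_finiteDimensional
  have hκc : Continuous κm := κm.continuous_of_finiteDimensional
  have hne : ∀ j, (LinearMap.proj j).comp κm ≠ (0 : (Fin p → ℝ) →ₗ[ℝ] ℝ) := by
    intro j hj
    obtain ⟨u, hu⟩ : ∃ u : Fin ν → ℝ, u = fun i => s (Pi.single i 1) j := ⟨_, rfl⟩
    have hφ : ∀ k, φ k u = (Pi.single j 1 : Fin m → ℝ) k := by
      intro k
      obtain ⟨r, hr⟩ : ∃ r : Fin ν → ℝ, r = fun i => φ k (Pi.single i 1) := ⟨_, rfl⟩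
      obtain ⟨w, hw⟩ := hκm_surj (Pi.single k 1 - s r) (by
        intro i
        simp only [Pi.sub_apply, sub_mul, Finset.sum_sub_distrib]
        rw [hs, hr]
        simp [Pi.single_apply])
      have h1 : κm w j = 0 := by
        have := LinearMap.congr_fun hj w
        simpa using this
      rw [hw] at h1
      have h2 : s r j = (Pi.single k 1 : Fin m → ℝ) j := by
        simp only [Pi.sub_apply] at h1
        linarith
      have h3 : s r j = φ k u := by
        have e1 : r = ∑ i, r i • (Pi.single i 1 : Fin ν → ℝ) := by
          ext q; simp [Finset.sum_apply, Pi.single_apply]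
        have e2 : u = ∑ i, u i • (Pi.single i 1 : Fin ν → ℝ) := by
          ext q; simp [Finset.sum_apply, Pi.single_apply]
        rw [e1, e2, map_sum, map_sum, Finset.sum_apply]
        refine Finset.sum_congr rfl (fun i _ => ?_)
        rw [map_smul, map_smul, hr, hu]
        simp [mul_comm]
      rw [← h3, h2]
      simp [Pi.single_apply, eq_comm]
    have hu0 := h0 u (fun k => by
      rw [hφ]
      by_cases h : k = j
      · subst h; simp
      · simp [h])
    have := hφ j
    rw [hu0] at this
    simp at this
  obtain ⟨Cs, hCs⟩ : ∃ Cs : ℝ, ∀ y' ∈ Metric.closedBall (0 : Fin ν → ℝ) 1, ‖s y'‖ ≤ Cs := by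
    exact (isCompact_closedBall _ _).exists_bound_of_continuousOn hsc.continuousOn
  refine continuousAt_of_dominated
    (bound := fun w => (∏ j, Real.exp (a j * Cs)) * ∏ j, Real.exp (-(a j * |κm w j|))) ?_ ?_ ?_ ?_
  · refine Eventually.of_forall (fun y' => ?_)
    apply Measurable.aestronglyMeasurable
    refine Finset.measurable_prod _ (fun j _ => ?_)
    have hm : Measurable (fun w => s y' j + κm w j) := by
      apply Continuous.measurable; fun_prop
    exact (ps_meas (a j)).comp hm
  · filter_upwards [Metric.closedBall_mem_nhds (0 : Fin ν → ℝ) one_pos] with y' hy'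
    refine Eventually.of_forall (fun w => ?_)
    rw [norm_prod, ← Finset.prod_mul_distrib]
    refine Finset.prod_le_prod (fun j _ => norm_nonneg _) (fun j _ => ?_)
    refine (ps_norm_le (ha j) _).trans ?_
    rw [← Real.exp_add]
    apply Real.exp_le_exp.2
    have h1 : |s y' j| ≤ Cs := (norm_le_pi_norm (s y') j).trans (hCs y' hy')
    have h2 : |κm w j| ≤ |s y' j + κm w j| + |s y' j| := by
      have := abs_sub (s y' j + κm w j) (s y' j)
      simpa using this
    nlinarith [ha j]
  · exact ((exp_dom a ha κm hκm_inj).const_mul _).smul_measure ENNReal.ofReal_ne_top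
  · have hae := ae_ne (fun j => (LinearMap.proj j).comp κm)
    have hae' : ∀ᵐ w ∂(ENNReal.ofReal t • (volume : Measure (Fin p → ℝ))), ∀ j,
        (LinearMap.proj j).comp κm ≠ (0 : (Fin p → ℝ) →ₗ[ℝ] ℝ) → (LinearMap.proj j).comp κm w ≠ 0 :=
      Measure.ae_smul_measure hae _
    filter_upwards [hae'] with w hw
    have hw' : ∀ j, κm w j ≠ 0 := fun j => hw j (hne j)
    refine tendsto_finsetProd _ (fun j _ => ?_)
    have h1 : ContinuousAt (fun y' : Fin ν → ℝ => s y' j + κm w j) 0 := by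
      apply Continuous.continuousAt; fun_prop
    have h2 : ContinuousAt (ps (a j)) ((fun y' : Fin ν → ℝ => s y' j + κm w j) 0) := by
      apply ps_contAt
      simpa using hw' j
    exact ContinuousAt.comp (f := fun y' : Fin ν → ℝ => s y' j + κm w j) h2 h1

theorem fourier_eval {ν m p : ℕ} (φ : Fin m → ((Fin ν → ℝ) →ₗ[ℝ] ℝ))
    (h0 : ∀ v, (∀ j, 0 ≤ φ j v) → v = 0) (a : Fin m → ℝ) (ha : ∀ j, 0 < a j)
    (s : (Fin ν → ℝ) →ₗ[ℝ] (Fin m → ℝ))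
    (hs : ∀ (y' : Fin ν → ℝ) (t : Fin ν), (∑ j, s y' j * φ j (Pi.single t 1)) = y' t)
    (κm : (Fin p → ℝ) →ₗ[ℝ] (Fin m → ℝ))
    (hκm_inj : Function.Injective κm)
    (hκm_ker : ∀ (w : Fin p → ℝ) (t : Fin ν), (∑ j, κm w j * φ j (Pi.single t 1)) = 0)
    (hκm_surj : ∀ y : Fin m → ℝ,
      (∀ t : Fin ν, (∑ j, y j * φ j (Pi.single t 1)) = 0) → ∃ w, κm w = y)
    (t : ℝ) (ht : 0 < t)
    (hmeas : Measure.map (fun p : (Fin ν → ℝ) × (Fin p → ℝ) => s p.1 + κm p.2)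
        ((volume : Measure (Fin ν → ℝ)).prod (ENNReal.ofReal t • volume)) = volume) :
    ((2 * Real.pi : ℂ) ^ ν)⁻¹ * ∫ u : Fin ν → ℝ, ∏ j, ((a j : ℂ) + Complex.I * (φ j u : ℝ))⁻¹ =
      ((t * ∫ w in {w : Fin p → ℝ | ∀ j, 0 ≤ κm w j},
            Real.exp (-∑ j, κm w j * a j) : ℝ) : ℂ) := by
  classical
  have hsc : Continuous s := s.continuous_of_finiteDimensional
  have hκc : Continuous κm := κm.continuous_of_finiteDimensional
  have hm : Measurable (fun p : (Fin ν → ℝ) × (Fin p → ℝ) => s p.1 + κm p.2) := by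
    apply Continuous.measurable; fun_prop
  obtain ⟨Φ, hΦ⟩ : ∃ Φ : (Fin m → ℝ) → ℂ, Φ = fun y => ∏ j, ps (a j) (y j) := ⟨_, rfl⟩
  have hΦm : Measurable Φ := by
    rw [hΦ]
    exact Finset.measurable_prod _ (fun j _ => (ps_meas (a j)).comp (measurable_pi_apply j))
  have hΦi : Integrable Φ := by
    rw [hΦ]
    exact Integrable.fintype_prod (f := fun j => ps (a j)) (fun j => ps_int (ha j))
  have hΦp : Integrable (fun q : (Fin ν → ℝ) × (Fin p → ℝ) => Φ (s q.1 + κm q.2))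
      ((volume : Measure (Fin ν → ℝ)).prod (ENNReal.ofReal t • volume)) := by
    have : Integrable Φ (Measure.map (fun p : (Fin ν → ℝ) × (Fin p → ℝ) => s p.1 + κm p.2)
        ((volume : Measure (Fin ν → ℝ)).prod (ENNReal.ofReal t • volume))) := by
      rw [hmeas]; exact hΦi
    exact this.comp_measurable hm
  obtain ⟨F, hF⟩ : ∃ F : (Fin ν → ℝ) → ℂ, F = fun y' => ∫ w : Fin p → ℝ, Φ (s y' + κm w)
      ∂(ENNReal.ofReal t • volume) := ⟨_, rfl⟩
  have hFi : Integrable F := by rw [hF]; exact hΦp.integral_prod_left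
  have hFc : ContinuousAt F 0 := by
    rw [hF, hΦ]
    exact F0_cont φ h0 a ha s hs κm hκm_inj hκm_surj t
  have hpair : ∀ (y' : Fin ν → ℝ) (w : Fin p → ℝ) (u : Fin ν → ℝ),
      ∑ j, (s y' + κm w) j * φ j u = ∑ i, y' i * u i := by
    intro y' w u
    have e2 : u = ∑ i, u i • (Pi.single i 1 : Fin ν → ℝ) := by
      ext q; simp [Finset.sum_apply, Pi.single_apply]
    have : ∀ j, φ j u = ∑ i, u i * φ j (Pi.single i 1) := by
      intro j
      conv_lhs => rw [e2]
      rw [map_sum]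
      exact Finset.sum_congr rfl (fun i _ => by rw [map_smul, smul_eq_mul])
    simp_rw [this, Finset.mul_sum]
    rw [Finset.sum_comm]
    refine Finset.sum_congr rfl (fun i _ => ?_)
    have h1 := hs y' i
    have h2 := hκm_ker w i
    calc ∑ j, (s y' + κm w) j * (u i * φ j (Pi.single i 1))
        = u i * (∑ j, s y' j * φ j (Pi.single i 1) + ∑ j, κm w j * φ j (Pi.single i 1)) := by
          rw [← Finset.sum_add_distrib, Finset.mul_sum]
          exact Finset.sum_congr rfl (fun j _ => by simp only [Pi.add_apply]; ring)
      _ = _ := by rw [h1, h2]; ring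
  have hFQ : ∀ u : Fin ν → ℝ,
      ∫ y : Fin ν → ℝ, Complex.exp (-(Complex.I * ((∑ t, y t * u t : ℝ) : ℂ))) * F y =
        ∏ j, ((a j : ℂ) + Complex.I * (φ j u : ℝ))⁻¹ := by
    intro u
    obtain ⟨H, hH⟩ : ∃ H : (Fin m → ℝ) → ℂ,
      H = fun y => Φ y * Complex.exp (-(Complex.I * ((∑ j, y j * φ j u : ℝ) : ℂ))) := ⟨_, rfl⟩
    have hHm : Measurable H := by
      rw [hH]
      refine hΦm.mul (Continuous.measurable ?_)
      fun_prop
    have hHi : Integrable H := by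
      refine hΦi.norm.mono' hHm.aestronglyMeasurable (Eventually.of_forall (fun y => ?_))
      rw [hH, norm_mul, Complex.norm_exp]
      simp
    have hHp : Integrable (fun q : (Fin ν → ℝ) × (Fin p → ℝ) => H (s q.1 + κm q.2))
      ((volume : Measure (Fin ν → ℝ)).prod (ENNReal.ofReal t • volume)) := by
      have : Integrable H (Measure.map (fun p : (Fin ν → ℝ) × (Fin p → ℝ) => s p.1 + κm p.2)
          ((volume : Measure (Fin ν → ℝ)).prod (ENNReal.ofReal t • volume))) := by
        rw [hmeas]; exact hHi
      exact this.comp_measurable hm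
    have e1 : ∫ y, H y = ∏ j, ((a j : ℂ) + Complex.I * (φ j u : ℝ))⁻¹ := by
      have : H = fun y => ∏ j, (ps (a j) (y j) *
          Complex.exp (-(Complex.I * ((y j * φ j u : ℝ) : ℂ)))) := by
        rw [hH, hΦ]
        ext y
        rw [Finset.prod_mul_distrib, ← Complex.exp_sum]
        congr 2
        push_cast
        rw [Finset.mul_sum, Finset.sum_neg_distrib]
      rw [this, integral_fintype_prod_volume_eq_prod (fun j (y : ℝ) => ps (a j) y *
          Complex.exp (-(Complex.I * ((y * φ j u : ℝ) : ℂ))))]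
      exact Finset.prod_congr rfl (fun j _ => ps_four (ha j) _)
    have e2 : ∫ y, H y = ∫ q : (Fin ν → ℝ) × (Fin p → ℝ), H (s q.1 + κm q.2)
        ∂((volume : Measure (Fin ν → ℝ)).prod (ENNReal.ofReal t • volume)) := by
      rw [← integral_map hm.aemeasurable hHm.aestronglyMeasurable, hmeas]
    rw [← e1, e2, integral_prod _ hHp]
    congr 1
    ext y'
    rw [hF, ← integral_const_mul]
    congr 1
    ext w
    rw [hH]
    simp only [hpair]
    ring
  rw [inv_zero F _ hFi (Q_int φ h0 a ha) hFQ hFc, hF]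
  simp only [map_zero, zero_add]
  rw [integral_smul_measure, ENNReal.toReal_ofReal ht.le, Complex.real_smul, Complex.ofReal_mul]
  congr 1
  rw [← integral_complex_ofReal, ← integral_indicator]
  · congr 1
    ext w
    rw [hΦ, Set.indicator_apply]
    split_ifs with h
    · have h' : ∀ j, 0 ≤ κm w j := h
      have : ∀ j, ps (a j) (κm w j) = Complex.exp (-(a j : ℂ) * (κm w j : ℝ)) := by
        intro j
        unfold ps
        rw [Set.indicator_of_mem (Set.mem_Ici.2 (h' j))]
      simp only [this]
      rw [← Complex.exp_sum]
      push_cast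
      congr 1
      rw [← Finset.sum_neg_distrib]
      exact Finset.sum_congr rfl (fun j _ => by ring)
    · have h' : ¬ ∀ j, 0 ≤ κm w j := h
      push Not at h'
      obtain ⟨j, hj⟩ := h'
      apply Finset.prod_eq_zero (Finset.mem_univ j)
      unfold ps
      rw [Set.indicator_of_notMem]
      simpa using hj
  · have : {w : Fin p → ℝ | ∀ j, 0 ≤ κm w j} = ⋂ j, {w | 0 ≤ κm w j} := by ext; simp
    rw [this]
    refine MeasurableSet.iInter (fun j => ?_)
    apply IsClosed.measurableSet
    exact isClosed_le continuous_const (by fun_prop)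

theorem near_limit {ν m : ℕ} (hνm : ν ≤ m) (φ : Fin m → ((Fin ν → ℝ) →ₗ[ℝ] ℝ))
    (h0 : ∀ v, (∀ j, 0 ≤ φ j v) → v = 0) (a : Fin m → ℝ) (ha : ∀ j, 0 < a j)
    (h : ℝ → (Fin ν → ℝ) → ℂ) (hcont : ∀ σ : ℝ, 0 < σ → σ ≤ 1 → Continuous (h σ))
    (M : ℝ) (hM0 : 0 ≤ M) (hM : ∀ σ : ℝ, 0 < σ → σ ≤ 1 → ∀ v, ‖v‖ ≤ 1 → ‖h σ v‖ ≤ M)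
    (g0 : ℂ) (hlim : ∀ u, Tendsto (fun σ : ℝ => h σ (σ • u)) (nhdsWithin 0 (Set.Ioi 0)) (nhds g0)) :
    Tendsto (fun σ : ℝ => ∫ v in Metric.closedBall (0 : Fin ν → ℝ) 1, (σ : ℂ) ^ (m - ν) *
        (h σ v * ∏ j, (1 + (((σ * a j : ℝ) : ℂ) + Complex.I * (φ j v : ℝ))⁻¹)))
      (nhdsWithin 0 (Set.Ioi 0))
      (nhds (g0 * ∫ u : Fin ν → ℝ, ∏ j, ((a j : ℂ) + Complex.I * (φ j u : ℝ))⁻¹)) := by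
  classical
  have hφc : ∀ j, Continuous (φ j) := fun j => (φ j).continuous_of_finiteDimensional
  have hσev : ∀ᶠ σ : ℝ in nhdsWithin 0 (Set.Ioi 0), 0 < σ ∧ σ ≤ 1 := by
    filter_upwards [Ioc_mem_nhdsGT (zero_lt_one (α := ℝ))] with σ hσ using hσ
  choose Cφ hCφ using fun j => (isCompact_closedBall (0 : Fin ν → ℝ) 1).exists_bound_of_continuousOn
    (hφc j).continuousOn
  have hCφ0 : ∀ j, 0 ≤ Cφ j := fun j => (norm_nonneg _).trans (hCφ j 0 (by simp))
  rw [← integral_const_mul]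
  obtain ⟨R, hR⟩ : ∃ R : ℝ → (Fin ν → ℝ) → ℂ, R = fun σ u =>
    Set.indicator {u : Fin ν → ℝ | ‖σ • u‖ ≤ 1}
      (fun u => h σ (σ • u) * ∏ j, ((σ : ℂ) + ((a j : ℂ) + Complex.I * (φ j u : ℝ))⁻¹)) u := ⟨_, rfl⟩
  have hsub : ∀ σ : ℝ, 0 < σ → ∫ v in Metric.closedBall (0 : Fin ν → ℝ) 1, (σ : ℂ) ^ (m - ν) *
        (h σ v * ∏ j, (1 + (((σ * a j : ℝ) : ℂ) + Complex.I * (φ j v : ℝ))⁻¹)) = ∫ u, R σ u := by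
    intro σ hσ
    have hσc : (σ : ℂ) ≠ 0 := by exact_mod_cast hσ.ne'
    rw [← integral_indicator Metric.isClosed_closedBall.measurableSet]
    have hi := Measure.integral_comp_smul (volume : Measure (Fin ν → ℝ))
      (Set.indicator (Metric.closedBall (0 : Fin ν → ℝ) 1) (fun v => (σ : ℂ) ^ (m - ν) *
        (h σ v * ∏ j, (1 + (((σ * a j : ℝ) : ℂ) + Complex.I * (φ j v : ℝ))⁻¹)))) σ
    simp only [Module.finrank_fintype_fun_eq_card, Fintype.card_fin] at hi
    rw [abs_of_pos (by positivity), Complex.real_smul] at hi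
    have hi2 : ∀ X : ℂ, X = (σ : ℂ) ^ ν * (((σ ^ ν)⁻¹ : ℝ) * X) := by
      intro X
      push_cast
      field_simp
    rw [hi2 (∫ v, _), ← hi, ← integral_const_mul]
    congr 1
    ext u
    rw [hR]
    simp only [Set.indicator_apply, mem_closedBall_zero_iff, Set.mem_ofPred_eq]
    split_ifs
    · have : (σ : ℂ) ^ ν * (σ : ℂ) ^ (m - ν) = ∏ j : Fin m, (σ : ℂ) := by
        rw [← pow_add, Finset.prod_const, Finset.card_univ, Fintype.card_fin]
        congr 1
        omega
      rw [← mul_assoc, this, mul_left_comm, ← Finset.prod_mul_distrib]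
      congr 1
      refine Finset.prod_congr rfl (fun j _ => ?_)
      have hq := ne_zero_of (ha j) (φ j u)
      have : (((σ * a j : ℝ) : ℂ) + Complex.I * (φ j (σ • u) : ℝ)) =
          σ * ((a j : ℂ) + Complex.I * (φ j u : ℝ)) := by
        rw [map_smul, smul_eq_mul]
        push_cast
        ring
      rw [this, mul_inv, mul_add, mul_one, ← mul_assoc, mul_inv_cancel₀ hσc, one_mul]
    · simp
  have hT : Tendsto (fun σ : ℝ => ∫ u, R σ u) (nhdsWithin 0 (Set.Ioi 0))
      (nhds (∫ u : Fin ν → ℝ, g0 * ∏ j, ((a j : ℂ) + Complex.I * (φ j u : ℝ))⁻¹)) := by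
    refine tendsto_integral_filter_of_dominated_convergence
      (fun u => M * ((∏ j, (1 + a j + Cφ j)) *
        ‖∏ j, ((a j : ℂ) + Complex.I * (φ j u : ℝ))⁻¹‖)) ?_ ?_ ?_ ?_
    · filter_upwards [hσev] with σ hσ
      rw [hR]
      apply Measurable.aestronglyMeasurable
      refine Measurable.indicator ?_ ?_
      · apply Continuous.measurable
        refine Continuous.mul ((hcont σ hσ.1 hσ.2).comp (by fun_prop)) ?_
        refine continuous_finsetProd _ (fun j _ => ?_)
        refine continuous_const.add ?_
        have := hφc j
        exact Continuous.inv₀ (by fun_prop) (fun u => ne_zero_of (ha j) _)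
      · apply IsClosed.measurableSet
        exact isClosed_le (by fun_prop) continuous_const
    · filter_upwards [hσev] with σ hσ
      refine Eventually.of_forall (fun u => ?_)
      rw [hR]
      have hnn : 0 ≤ ∏ j, (1 + a j + Cφ j) :=
        Finset.prod_nonneg (fun j _ => by have := ha j; have := hCφ0 j; positivity)
      simp only [Set.indicator_apply, Set.mem_ofPred_eq]
      split_ifs with hu
      · rw [norm_mul]
        refine mul_le_mul (hM σ hσ.1 hσ.2 _ hu) ?_ (norm_nonneg _) hM0
        rw [norm_prod, norm_prod, ← Finset.prod_mul_distrib]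
        refine Finset.prod_le_prod (fun j _ => norm_nonneg _) (fun j _ => ?_)
        have hq := ne_zero_of (ha j) (φ j u)
        have e1 : (σ : ℂ) + ((a j : ℂ) + Complex.I * (φ j u : ℝ))⁻¹ =
          (1 + (((σ * a j : ℝ) : ℂ) + Complex.I * (φ j (σ • u) : ℝ))) *
            ((a j : ℂ) + Complex.I * (φ j u : ℝ))⁻¹ := by
          rw [map_smul, smul_eq_mul]
          push_cast
          field_simp
          ring
        rw [e1, norm_mul]
        refine mul_le_mul_of_nonneg_right ?_ (norm_nonneg _)
        have hb := hCφ j (σ • u) (by simpa using hu)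
        calc ‖(1 : ℂ) + (((σ * a j : ℝ) : ℂ) + Complex.I * (φ j (σ • u) : ℝ))‖
            ≤ ‖(1 : ℂ)‖ + (‖((σ * a j : ℝ) : ℂ)‖ + ‖Complex.I * (φ j (σ • u) : ℝ)‖) :=
              (norm_add_le _ _).trans (add_le_add le_rfl (norm_add_le _ _))
          _ ≤ 1 + (a j + Cφ j) := by
              refine add_le_add (by simp) (add_le_add ?_ ?_)
              · rw [Complex.norm_real, Real.norm_of_nonneg (mul_nonneg hσ.1.le (ha j).le)]
                nlinarith [ha j, hσ.2]
              · rw [norm_mul, Complex.norm_I, one_mul, Complex.norm_real]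
                exact hb
          _ = _ := by ring
      · rw [norm_zero]
        positivity
    · exact ((Q_int φ h0 a ha).norm.const_mul _).const_mul _
    · refine Eventually.of_forall (fun u => ?_)
      have hσ0 : Tendsto (fun σ : ℝ => σ) (nhdsWithin 0 (Set.Ioi 0)) (nhds 0) :=
        tendsto_id.mono_left nhdsWithin_le_nhds
      have hσu : Tendsto (fun σ : ℝ => ‖σ • u‖) (nhdsWithin 0 (Set.Ioi 0)) (nhds 0) := by
        have := (hσ0.smul_const u).norm
        simpa using this
      have hev : ∀ᶠ σ : ℝ in nhdsWithin 0 (Set.Ioi 0), ‖σ • u‖ ≤ 1 :=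
        (hσu.eventually (gt_mem_nhds zero_lt_one)).mono (fun _ h => h.le)
      have hmain : Tendsto (fun σ : ℝ => h σ (σ • u) *
          ∏ j, ((σ : ℂ) + ((a j : ℂ) + Complex.I * (φ j u : ℝ))⁻¹)) (nhdsWithin 0 (Set.Ioi 0))
          (nhds (g0 * ∏ j, ((a j : ℂ) + Complex.I * (φ j u : ℝ))⁻¹)) := by
        refine (hlim u).mul (tendsto_finsetProd _ (fun j _ => ?_))
        have hc : Tendsto (fun σ : ℝ => (σ : ℂ)) (nhdsWithin 0 (Set.Ioi 0)) (nhds 0) := by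
          have := (Complex.continuous_ofReal.tendsto 0).comp hσ0
          simpa [Function.comp_def] using this
        simpa using hc.add_const (((a j : ℂ) + Complex.I * (φ j u : ℝ))⁻¹)
      refine hmain.congr' ?_
      filter_upwards [hev] with σ hσ
      rw [hR]
      simp only [Set.indicator_apply, Set.mem_ofPred_eq]
      rw [if_pos hσ]
  refine hT.congr' ?_
  filter_upwards [hσev] with σ hσ
  exact (hsub σ hσ.1).symm

theorem abstract_main {ν m : ℕ} (hνm : ν ≤ m) (φ : Fin m → ((Fin ν → ℝ) →ₗ[ℝ] ℝ))
    (h0 : ∀ v, (∀ j, 0 ≤ φ j v) → v = 0) (a : Fin m → ℝ) (ha : ∀ j, 0 < a j)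
    (c : (Fin ν → ℝ) → ℝ) (hc0 : ∀ v, 0 ≤ c v) (hcm : Measurable c) (hci : Integrable c)
    (κ : ℝ) (hκ : 0 < κ)
    (h : ℝ → (Fin ν → ℝ) → ℂ) (hcont : ∀ σ : ℝ, 0 < σ → σ ≤ 1 → Continuous (h σ))
    (hbd : ∀ σ : ℝ, 0 < σ → σ ≤ 1 → ∀ v s, dist v s ≤ 1 → ‖h σ v‖ ≤ κ * c s)
    (g0 : ℂ) (hlim : ∀ u, Tendsto (fun σ : ℝ => h σ (σ • u)) (nhdsWithin 0 (Set.Ioi 0)) (nhds g0)) :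
    Tendsto (fun σ : ℝ => (σ : ℂ) ^ (m - ν) * ∫ v,
        (h σ v * ∏ j, (1 + (((σ * a j : ℝ) : ℂ) + Complex.I * (φ j v : ℝ))⁻¹)))
      (nhdsWithin 0 (Set.Ioi 0))
      (nhds (g0 * ∫ u : Fin ν → ℝ, ∏ j, ((a j : ℂ) + Complex.I * (φ j u : ℝ))⁻¹)) := by
  classical
  have hφc : ∀ j, Continuous (φ j) := fun j => (φ j).continuous_of_finiteDimensional
  have hσev : ∀ᶠ σ : ℝ in nhdsWithin 0 (Set.Ioi 0), 0 < σ ∧ σ ≤ 1 := by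
    filter_upwards [Ioc_mem_nhdsGT (zero_lt_one (α := ℝ))] with σ hσ using hσ
  have hnear := near_limit hνm φ h0 a ha h hcont (κ * c 0) (mul_nonneg hκ.le (hc0 0))
    (fun σ h1 h2 v hv => hbd σ h1 h2 v 0 (by simpa using hv)) g0 hlim
  obtain ⟨D, hD, hfar⟩ := far_bound φ h0 a ha c hc0 hcm hci κ hκ
  obtain ⟨fs, hfs⟩ : ∃ fs : ℝ → (Fin ν → ℝ) → ℂ, fs = fun (σ : ℝ) v => (σ : ℂ) ^ (m - ν) *
        (h σ v * ∏ j, (1 + (((σ * a j : ℝ) : ℂ) + Complex.I * (φ j v : ℝ))⁻¹)) := ⟨_, rfl⟩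
  have hfsc : ∀ σ : ℝ, 0 < σ → σ ≤ 1 → Continuous (fs σ) := by
    intro σ hσ hσ1
    rw [hfs]
    refine continuous_const.mul ((hcont σ hσ hσ1).mul ?_)
    refine continuous_finsetProd _ (fun j _ => continuous_const.add ?_)
    have := hφc j
    exact Continuous.inv₀ (by fun_prop) (fun u => ne_zero_of (mul_pos hσ (ha j)) _)
  have hlin : ∀ σ : ℝ, 0 < σ → σ ≤ 1 → ∫⁻ v in (Metric.closedBall (0 : Fin ν → ℝ) 1)ᶜ,
      ENNReal.ofReal ‖fs σ v‖ ≤ D * ENNReal.ofReal (σ ^ (1 / ((ν : ℝ) + 1))) := by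
    intro σ hσ hσ1
    refine le_trans (lintegral_mono (fun v => ?_)) (hfar σ hσ hσ1 (fun v => ‖h σ v‖)
      (hcont σ hσ hσ1).norm.measurable (fun v => norm_nonneg _) (hbd σ hσ hσ1))
    apply ENNReal.ofReal_le_ofReal
    rw [hfs, norm_mul, norm_mul, norm_pow, Complex.norm_real, Real.norm_of_nonneg hσ.le, norm_prod]
    refine mul_le_mul_of_nonneg_left (mul_le_mul_of_nonneg_left ?_ (norm_nonneg _)) (by positivity)
    refine Finset.prod_le_prod (fun j _ => norm_nonneg _) (fun j _ => ?_)
    refine (norm_add_le _ _).trans (add_le_add (by simp) ?_)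
    rw [norm_inv, one_div]
    have hp := mul_pos hσ (ha j)
    refine inv_anti₀ (lt_of_lt_of_le hp (le_max_left _ _)) (max_le ?_ (norm_ge_right _ _))
    exact (le_abs_self _).trans (norm_ge_left _ _)
  have hfin : ∀ σ : ℝ, D * ENNReal.ofReal (σ ^ (1 / ((ν : ℝ) + 1))) ≠ ⊤ :=
    fun σ => ENNReal.mul_ne_top hD ENNReal.ofReal_ne_top
  have hint : ∀ σ : ℝ, 0 < σ → σ ≤ 1 → Integrable (fs σ) := by
    intro σ hσ hσ1
    rw [← integrableOn_univ, ← Set.union_compl_self (Metric.closedBall (0 : Fin ν → ℝ) 1)]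
    refine IntegrableOn.union ((hfsc σ hσ hσ1).continuousOn.integrableOn_compact
      (isCompact_closedBall _ _)) ⟨(hfsc σ hσ hσ1).aestronglyMeasurable, ?_⟩
    rw [hasFiniteIntegral_iff_norm]
    exact lt_of_le_of_lt (hlin σ hσ hσ1) (hfin σ).lt_top
  have hfarlim : Tendsto (fun σ : ℝ => ∫ v in (Metric.closedBall (0 : Fin ν → ℝ) 1)ᶜ, fs σ v)
      (nhdsWithin 0 (Set.Ioi 0)) (nhds 0) := by
    have hpow : Tendsto (fun σ : ℝ => D.toReal * σ ^ (1 / ((ν : ℝ) + 1)))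
        (nhdsWithin 0 (Set.Ioi 0)) (nhds 0) := by
      have h1 : 0 < 1 / ((ν : ℝ) + 1) := by positivity
      have h2 : ContinuousAt (fun σ : ℝ => σ ^ (1 / ((ν : ℝ) + 1))) 0 :=
        Real.continuousAt_rpow_const _ _ (Or.inr h1.le)
      have h3 := (h2.tendsto.mono_left (nhdsWithin_le_nhds (s := Set.Ioi 0))).const_mul D.toReal
      rw [Real.zero_rpow h1.ne', mul_zero] at h3
      exact h3
    refine squeeze_zero_norm' ?_ hpow
    filter_upwards [hσev] with σ hσ
    refine (norm_integral_le_lintegral_norm _).trans ?_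
    refine (ENNReal.toReal_mono (hfin σ) (hlin σ hσ.1 hσ.2)).trans ?_
    rw [ENNReal.toReal_mul, ENNReal.toReal_ofReal (Real.rpow_nonneg hσ.1.le _)]
  have hsum := hnear.add hfarlim
  rw [add_zero] at hsum
  refine hsum.congr' ?_
  filter_upwards [hσev] with σ hσ
  have := integral_add_compl (Metric.isClosed_closedBall (x := (0 : Fin ν → ℝ)) (ε := 1)).measurableSet
    (hint σ hσ.1 hσ.2)
  rw [← integral_const_mul]
  rw [hfs] at this ⊢
  exact this

end S3

/-!
Statement 3.  Via the linearly independent forms `l_1, …, l_m`, the quotient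
`E_0 = E/E^{(0)}` (where `E^{(0)} = ∩_j ker l_j`) is identified with `ℝ^m`
through `x ↦ (l_1(x), …, l_m(x))`; under this identification `π_0 = L` is this
map, `E_0^+` is the nonnegative orthant, the dual `E_0^∨` is `ℝ^m` with the
lattice `⊕_j ℤ l_j` becoming `ℤ^m` (so `dy` is the standard Lebesgue measure),
and the forms `l_j` on `E_0` become the coordinates.  The measure `dv` on `V`
is normalized by the lattice `A`, i.e. in the fixed coordinates `V ≅ ℝ^ν`
(carrying the standard Lebesgue measure) `A` has covolume one; consequently the
measure `dy'` on `V^∨` normalized by `A^∨` is the standard Lebesgue measure of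
`ℝ^ν ≅ V^∨` (dual coordinates).  The restriction map `ρ : E_0^∨ → V^∨` is
`ρ(y)_t = ∑_j y_j · l_j(ι e_t)`; the annihilator `ker ρ` of `π_0(V)` is
`P^∨ = (E_0/π_0(V))^∨`, parametrized by an injective linear map
`κm : ℝ^{m-ν} → ℝ^m` with range `ker ρ`; the measure `dy''` on `P^∨`
corresponds to `t · (Lebesgue)` on `ℝ^{m-ν}`, where `t > 0` is determined by
`dy = dy' dy''`, i.e. the map `(y', w) ↦ s(y') + κm(w)` (for a section `s` of
`ρ`) pushes `dy' ⊗ (t·Lebesgue)` to `dy`.  The dual cone `Λ^∨ ⊆ P^∨` is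
`{y ∈ ker ρ | y_j ≥ 0 ∀ j}`, and for `x̄ = ψ_0(π_0(x_0))`,
`𝒳_Λ(x̄) = ∫_{Λ^∨} e^{-y''(x̄)} dy''
        = t ∫_{{w | κm(w)_j ≥ 0 ∀ j}} e^{-∑_j κm(w)_j l_j(x_0)} dw`.
-/
theorem statement3 {n ν m : ℕ} (f g : (Fin n → ℂ) → ℂ)
    (B : Set (Fin n → ℝ)) (l : Fin m → (Fin n → ℝ))
    (ι : (Fin ν → ℝ) →ₗ[ℝ] (Fin n → ℝ)) (c : (Fin ν → ℝ) → ℝ)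
    (hdist : Distinguished f g B l ι c)
    -- `C` is a connected component of `B \ ∪_j ker l_j`
    (C : Set (Fin n → ℝ))
    (hC : ∃ x₀ ∈ B \ ⋃ j, {x | lR (l j) x = 0},
      C = connectedComponentIn (B \ ⋃ j, {x | lR (l j) x = 0}) x₀)
    (hνm : ν ≤ m)
    -- `V ∩ E^{(0)} = {0}`
    (hV0 : ∀ w : Fin ν → ℝ, (∀ j, lR (l j) (ι w) = 0) → w = 0)
    -- `π_0(V) ∩ E_0^+ = {0}`
    (hWplus : ∀ w : Fin ν → ℝ, (∀ j, 0 ≤ lR (l j) (ι w)) → w = 0)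
    -- a section `s : V^∨ → E_0^∨` of the restriction map `ρ : E_0^∨ → V^∨`
    (s : (Fin ν → ℝ) →ₗ[ℝ] (Fin m → ℝ))
    (hs : ∀ (y' : Fin ν → ℝ) (t : Fin ν),
      (∑ j, s y' j * lR (l j) (ι (Pi.single t 1))) = y' t)
    -- a linear parametrization `κm` of `P^∨ = ker ρ ⊆ E_0^∨`
    (κm : (Fin (m - ν) → ℝ) →ₗ[ℝ] (Fin m → ℝ))
    (hκm_inj : Function.Injective κm)
    (hκm_ker : ∀ (w : Fin (m - ν) → ℝ) (t : Fin ν),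
      (∑ j, κm w j * lR (l j) (ι (Pi.single t 1))) = 0)
    (hκm_surj : ∀ y : Fin m → ℝ,
      (∀ t : Fin ν, (∑ j, y j * lR (l j) (ι (Pi.single t 1))) = 0) →
      ∃ w, κm w = y)
    -- the normalizing constant `t > 0` making `dy = dy' dy''`
    (t : ℝ) (ht : 0 < t)
    (hmeas : MeasureTheory.Measure.map
        (fun p : (Fin ν → ℝ) × (Fin (m - ν) → ℝ) => s p.1 + κm p.2)
        ((MeasureTheory.volume : MeasureTheory.Measure (Fin ν → ℝ)).prod
          (ENNReal.ofReal t • MeasureTheory.volume))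
      = MeasureTheory.volume)
    -- `x₀ ∈ B^+`
    (x₀ : Fin n → ℝ) (hx₀B : x₀ ∈ B) (hx₀pos : ∀ j, 0 < lR (l j) x₀) :
    -- `lim_{σ → 0⁺} σ^{m-ν} f̃_C(σ x₀) = g(0) · 𝒳_Λ(ψ_0(π_0(x₀)))`
    Tendsto
      (fun σ : ℝ => (σ : ℂ) ^ (m - ν) *
        ftil f ι (fun k => ((σ * x₀ k : ℝ) : ℂ)))
      (nhdsWithin 0 (Set.Ioi 0))
      (nhds (g 0 *
        ((t * ∫ w in {w : Fin (m - ν) → ℝ | ∀ j, 0 ≤ κm w j},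
            Real.exp (-∑ j, κm w j * lR (l j) x₀) : ℝ) : ℂ))) := by
  classical
  obtain ⟨φ, hφ⟩ : ∃ φ : Fin m → ((Fin ν → ℝ) →ₗ[ℝ] ℝ), ∀ j v, φ j v = lR (l j) (ι v) := by
    refine ⟨fun j => { toFun := fun v => lR (l j) (ι v), map_add' := ?_, map_smul' := ?_ },
      fun j v => rfl⟩
    · intro x y
      simp only [lR, map_add, Pi.add_apply, mul_add, Finset.sum_add_distrib]
    · intro r x
      simp only [lR, map_smul, Pi.smul_apply, smul_eq_mul, RingHom.id_apply, Finset.mul_sum]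
      exact Finset.sum_congr rfl (fun i _ => by ring)
  obtain ⟨a, hadef⟩ : ∃ a : Fin m → ℝ, ∀ j, a j = lR (l j) x₀ := ⟨_, fun j => rfl⟩
  have ha : ∀ j, 0 < a j := fun j => by rw [hadef]; exact hx₀pos j
  have h0 : ∀ v, (∀ j, 0 ≤ φ j v) → v = 0 := fun v hv => hWplus v (fun j => by
    rw [← hφ]; exact hv j)
  simp only [← hφ, ← hadef] at hs hκm_ker hκm_surj ⊢
  have hιc : Continuous ι := ι.continuous_of_finiteDimensional
  have hfe := S3.fourier_eval φ h0 a ha s hs κm hκm_inj hκm_ker hκm_surj t ht hmeas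
  -- the sufficient function
  have hc1 := (hdist.hc_suff ν LinearMap.id Function.injective_id).1 0
  simp only [zero_add, LinearMap.id_apply] at hc1
  have hcm : Measurable c := hc1.1
  have hci : Integrable c := hc1.2
  -- points of the tube
  have hmem : ∀ σ : ℝ, 0 ≤ σ → σ ≤ 1 → ∀ x : Fin n → ℝ,
      addI (fun k => ((σ * x₀ k : ℝ) : ℂ)) x ∈ tube B := by
    intro σ hσ hσ1 x
    have : σ • x₀ ∈ B := hdist.hB_convex.smul_mem_of_zero_mem hdist.hB_zero hx₀B ⟨hσ, hσ1⟩
    have he : (fun k => (addI (fun k => ((σ * x₀ k : ℝ) : ℂ)) x k).re) = σ • x₀ := by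
      ext k
      simp [addI]
    change (fun k => (addI (fun k => ((σ * x₀ k : ℝ) : ℂ)) x k).re) ∈ B
    rw [he]
    exact this
  have hjc : Continuous (fun q : ℝ × (Fin ν → ℝ) =>
      addI (fun k => ((q.1 * x₀ k : ℝ) : ℂ)) (ι q.2)) := by
    unfold addI
    fun_prop
  have hopen : IsOpen (tube B) := by
    have : Continuous (fun z : Fin n → ℂ => fun k => (z k).re) := by fun_prop
    exact hdist.hB_open.preimage this
  have hgc : ContinuousOn g (tube B) := hdist.hg_holo.continuousOn
  -- the bound
  obtain ⟨κ, hκ, hκb⟩ := hdist.hbound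
    ((fun q : ℝ × (Fin ν → ℝ) => addI (fun k => ((q.1 * x₀ k : ℝ) : ℂ)) (ι q.2)) ''
      (Set.Icc 0 1 ×ˢ Metric.closedBall 0 1))
    (by
      rintro _ ⟨q, hq, rfl⟩
      exact hmem q.1 hq.1.1 hq.1.2 _)
    ((isCompact_Icc.prod (isCompact_closedBall _ _)).image hjc)
  obtain ⟨h, hh⟩ : ∃ h : ℝ → (Fin ν → ℝ) → ℂ, ∀ σ v,
    h σ v = g (addI (fun k => ((σ * x₀ k : ℝ) : ℂ)) (ι v)) := ⟨_, fun _ _ => rfl⟩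
  have hcont : ∀ σ : ℝ, 0 < σ → σ ≤ 1 → Continuous (h σ) := by
    intro σ hσ hσ1
    have he : h σ = fun v => g (addI (fun k => ((σ * x₀ k : ℝ) : ℂ)) (ι v)) := funext (hh σ)
    rw [he]
    exact hgc.comp_continuous (hjc.comp (Continuous.prodMk_right σ)) (fun v => hmem σ hσ.le hσ1 _)
  have hbd : ∀ σ : ℝ, 0 < σ → σ ≤ 1 → ∀ v s, dist v s ≤ 1 → ‖h σ v‖ ≤ κ * c s := by
    intro σ hσ hσ1 v s hvs
    have := hκb _ ⟨(σ, v - s), ⟨⟨hσ.le, hσ1⟩, by simpa [dist_eq_norm] using hvs⟩, rfl⟩ s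
    have he : addI (addI (fun k => ((σ * x₀ k : ℝ) : ℂ)) (ι (v - s))) (ι s) =
        addI (fun k => ((σ * x₀ k : ℝ) : ℂ)) (ι v) := by
      ext k
      simp only [addI, map_sub, Pi.sub_apply]
      push_cast
      ring
    simp only at this
    rw [he] at this
    rw [hh]
    exact this
  have hlim : ∀ u, Tendsto (fun σ : ℝ => h σ (σ • u)) (nhdsWithin 0 (Set.Ioi 0)) (nhds (g 0)) := by
    intro u
    have h0t : (0 : Fin n → ℂ) ∈ tube B := by
      have := hdist.hB_zero
      simpa [tube, Pi.zero_def] using this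
    have hg0 : ContinuousAt g 0 := hgc.continuousAt (hopen.mem_nhds h0t)
    have hpath : Tendsto (fun σ : ℝ => addI (fun k => ((σ * x₀ k : ℝ) : ℂ)) (ι (σ • u)))
        (nhdsWithin 0 (Set.Ioi 0)) (nhds 0) := by
      have hcc : Continuous (fun σ : ℝ => addI (fun k => ((σ * x₀ k : ℝ) : ℂ)) (ι (σ • u))) :=
        hjc.comp (continuous_id.prodMk (by fun_prop))
      have h1 := hcc.tendsto 0
      have he : addI (fun k => (((0 : ℝ) * x₀ k : ℝ) : ℂ)) (ι ((0 : ℝ) • u)) = 0 := by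
        ext k
        simp [addI]
      rw [he] at h1
      exact h1.mono_left nhdsWithin_le_nhds
    have h2 := hg0.tendsto.comp hpath
    refine h2.congr (fun σ => ?_)
    rw [hh]
    rfl
  have hmain := S3.abstract_main hνm φ h0 a ha c hdist.hc_nonneg hcm hci κ hκ h hcont hbd (g 0) hlim
  rw [← hfe]
  have hmain2 := hmain.const_mul ((2 * Real.pi : ℂ) ^ ν)⁻¹
  rw [mul_left_comm] at hmain2
  refine hmain2.congr' ?_
  filter_upwards [Ioc_mem_nhdsGT (zero_lt_one (α := ℝ))] with σ hσ
  unfold ftil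
  rw [mul_left_comm]
  congr 3
  ext v
  rw [hh]
  have hz := hmem σ hσ.1.le hσ.2 (ι v)
  have hl : ∀ j, lC (l j) (addI (fun k => ((σ * x₀ k : ℝ) : ℂ)) (ι v)) =
      ((σ * a j : ℝ) : ℂ) + Complex.I * (φ j v : ℝ) := by
    intro j
    rw [hadef, hφ]
    simp only [lC, lR, addI]
    push_cast
    rw [Finset.mul_sum, Finset.mul_sum, ← Finset.sum_add_distrib]
    exact Finset.sum_congr rfl (fun k _ => by ring)
  have hne : ∀ j, ((σ * a j : ℝ) : ℂ) + Complex.I * (φ j v : ℝ) ≠ 0 :=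
    fun j => S3.ne_zero_of (mul_pos hσ.1 (ha j)) _
  have hne1 : ∀ j, ((σ * a j : ℝ) : ℂ) + Complex.I * (φ j v : ℝ) + 1 ≠ 0 := by
    intro j
    have := S3.ne_zero_of (add_pos (mul_pos hσ.1 (ha j)) one_pos) (φ j v)
    intro hcon
    apply this
    rw [← hcon]
    push_cast
    ring
  rw [hdist.hfg _ hz (fun j => by rw [hl]; exact hne j), mul_assoc, ← Finset.prod_mul_distrib]
  simp only [hl]
  rw [Finset.prod_eq_one, mul_one]
  intro j _
  have e1 := hne j
  have e2 := hne1 j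
  generalize ((σ * a j : ℝ) : ℂ) + Complex.I * (φ j v : ℝ) = q at e1 e2 ⊢
  field_simp
end

section
/- Let V be a d-dimensional real vector space, let (l_1, …, l_d) be a basis of the dual space V^∨, fix ε > 0, and define c : V → (0,∞) by c(v) = ∏_{j=1}^d (1 + |l_j(v)|)^{−(1+ε)}. Let U ⊆ V be a linear subspace with a chosen Lebesgue measure du, and set d' = dim V/U. Then there exist a positive constant κ = κ(ε, U, du) and a finite family {(l_{α,1}, …, l_{α,d'})}_{α ∈ A} of bases of (V/U)^∨ such that for all v ∈ V, ∫_U c(v + u) du ≤ κ · Σ_{α ∈ A} ∏_{j=1}^{d'} (1 + |l_{α,j}(v̄)|)^{−(1+ε)}, where v̄ denotes the image of v in V/U. -/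
open MeasureTheory
open scoped BigOperators

lemma aux_cramer {k : ℕ} (M : Matrix (Fin k) (Fin k) ℝ) (hM : M.det ≠ 0) (r : Fin k → ℝ)
    (a : Fin k) : (Matrix.vecMul r M⁻¹) a = (M.updateRow a r).det / M.det := by
  rw [Matrix.inv_def, Matrix.vecMul_smul, ← Matrix.cramer_transpose_apply,
    Matrix.cramer_eq_adjugate_mulVec, ← Matrix.adjugate_transpose, Matrix.mulVec_transpose,
    Ring.inverse_eq_inv']
  simp [div_eq_inv_mul]

lemma aux_key {d k : ℕ} (m : Matrix (Fin d) (Fin k) ℝ)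
    (hm : ∃ e : Fin k → Fin d, (m.submatrix e id).det ≠ 0) (x : Fin d → ℝ) :
    ∃ e : Fin k → Fin d, (m.submatrix e id).det ≠ 0 ∧
      ∀ i, 1 + |x i - ∑ a, (Matrix.vecMul (m i) (m.submatrix e id)⁻¹) a * x (e a)|
        ≤ (k + 1) * (1 + |x i|) := by
  obtain ⟨e0, he0⟩ := hm
  have hp : ∀ i, 0 < 1 + |x i| := fun i => by positivity
  obtain ⟨e, -, he⟩ := Finset.exists_max_image (Finset.univ : Finset (Fin k → Fin d))
    (fun e => |(m.submatrix e id).det| * ∏ a, (1 + |x (e a)|)⁻¹) ⟨e0, Finset.mem_univ _⟩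
  have hpp : ∀ e : Fin k → Fin d, 0 < ∏ a, (1 + |x (e a)|)⁻¹ := fun e =>
    Finset.prod_pos fun a _ => inv_pos.2 (hp _)
  have hdet : (m.submatrix e id).det ≠ 0 := by
    intro h
    have := he e0 (Finset.mem_univ _)
    rw [h] at this
    have h2 := mul_pos (abs_pos.2 he0) (hpp e0)
    simp only [abs_zero, zero_mul] at this
    linarith
  refine ⟨e, hdet, fun i => ?_⟩
  have hb : ∀ a, |(Matrix.vecMul (m i) (m.submatrix e id)⁻¹) a * x (e a)| ≤ 1 + |x i| := by
    intro a
    have h1 := he (Function.update e a i) (Finset.mem_univ _)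
    have h2 : m.submatrix (Function.update e a i) id
        = (m.submatrix e id).updateRow a (m i) := by
      ext p q
      by_cases hpa : p = a
      · subst hpa; simp
      · simp [hpa]
    rw [h2] at h1
    rw [aux_cramer _ hdet, abs_mul, abs_div]
    rw [← Finset.mul_prod_erase _ _ (Finset.mem_univ a),
      ← Finset.mul_prod_erase (Finset.univ) (fun b => (1 + |x (e b)|)⁻¹) (Finset.mem_univ a)] at h1
    have h3 : ∏ b ∈ Finset.univ.erase a, (1 + |x (Function.update e a i b)|)⁻¹
        = ∏ b ∈ Finset.univ.erase a, (1 + |x (e b)|)⁻¹ := by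
      apply Finset.prod_congr rfl
      intro b hb
      rw [Function.update_of_ne (Finset.ne_of_mem_erase hb)]
    rw [h3, Function.update_self, ← mul_assoc, ← mul_assoc] at h1
    have h4 : 0 < ∏ b ∈ Finset.univ.erase a, (1 + |x (e b)|)⁻¹ :=
      Finset.prod_pos fun a _ => inv_pos.2 (hp _)
    have h5 := le_of_mul_le_mul_right h1 h4
    have hd : 0 < |(m.submatrix e id).det| := abs_pos.2 hdet
    have h6 : |((m.submatrix e id).updateRow a (m i)).det| * (1 + |x (e a)|)
        ≤ |(m.submatrix e id).det| * (1 + |x i|) := by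
      rw [← div_eq_mul_inv, ← div_eq_mul_inv, div_le_div_iff₀ (hp _) (hp _)] at h5
      exact h5
    rw [div_mul_eq_mul_div, div_le_iff₀ hd]
    nlinarith [abs_nonneg ((m.submatrix e id).updateRow a (m i)).det]
  calc _ ≤ 1 + (|x i| + ∑ a : Fin k, (1 + |x i|)) := by
        gcongr
        refine (abs_sub _ _).trans ?_
        gcongr
        exact (Finset.abs_sum_le_sum_abs _ _).trans (Finset.sum_le_sum fun a _ => hb a)
    _ = _ := by simp; ring

lemma aux_exists {d k : ℕ} (m : Matrix (Fin d) (Fin k) ℝ) (hm : Function.Injective m.mulVec) :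
    ∃ e : Fin k → Fin d, (m.submatrix e id).det ≠ 0 := by
  have hr : m.rank = k := by
    have : Function.Injective m.mulVecLin := hm
    rw [Matrix.rank, LinearMap.finrank_range_of_inj this]; simp
  rw [Matrix.rank_eq_finrank_span_row] at hr
  obtain ⟨κ, a, ha, hs, hli⟩ := exists_linearIndependent' ℝ m.row
  have : Finite κ := Finite.of_injective a ha
  have := Fintype.ofFinite κ
  have hc : Fintype.card κ = k := by
    rw [← finrank_span_eq_card hli, hs, hr]
  let σ : Fin k ≃ κ := (Fintype.equivFinOfCardEq hc).symm
  refine ⟨a ∘ σ, ?_⟩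
  have h2 : LinearIndependent ℝ (m.submatrix (a ∘ σ) id).row := hli.comp σ σ.injective
  have := Matrix.linearIndependent_rows_iff_isUnit.1 h2
  rw [Matrix.isUnit_iff_isUnit_det] at this
  exact this.ne_zero

lemma aux_int {k : ℕ} (M : Matrix (Fin k) (Fin k) ℝ) (hM : M.det ≠ 0) (ε : ℝ) (hε : 0 < ε) :
    ∃ C : ℝ, 0 ≤ C ∧ ∀ p : Fin k → ℝ,
      Integrable (fun w => ∏ a, (1 + |p a + M.mulVec w a|) ^ (-(1 + ε))) ∧
      ∫ w, ∏ a, (1 + |p a + M.mulVec w a|) ^ (-(1 + ε)) = C := by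
  let F : (Fin k → ℝ) → ℝ := fun y => ∏ a, (1 + |y a|) ^ (-(1 + ε))
  have h1 : Integrable (fun x : ℝ => (1 + |x|) ^ (-(1 + ε))) := by
    have := integrable_one_add_norm (E := ℝ) (μ := volume) (r := 1 + ε) (by simp; exact hε)
    simpa using this
  have hF : Integrable F := Integrable.fintype_prod (fun _ => h1)
  have hmap := Real.map_matrix_volume_pi_eq_smul_volume_pi hM
  have hmeas : Measurable (Matrix.toLin' M) :=
    (LinearMap.continuous_of_finiteDimensional _).measurable
  refine ⟨|M.det⁻¹| * ∫ y, F y, ?_, fun p => ?_⟩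
  · refine mul_nonneg (abs_nonneg _) (integral_nonneg fun y => ?_)
    exact Finset.prod_nonneg fun a _ => by positivity
  have hG : Integrable (fun y => F (p + y)) := hF.comp_add_left p
  have hG' : Integrable (fun y => F (p + y)) (Measure.map (Matrix.toLin' M) volume) := by
    rw [hmap]; exact hG.smul_measure ENNReal.ofReal_ne_top
  constructor
  · exact (integrable_map_measure hG'.aestronglyMeasurable hmeas.aemeasurable).1 hG'
  · have := integral_map hmeas.aemeasurable hG'.aestronglyMeasurable
    rw [hmap, integral_smul_measure, integral_add_left_eq_self F p,
      ENNReal.toReal_ofReal (abs_nonneg _), smul_eq_mul] at this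
    exact this.symm

lemma aux_equiv {d k : ℕ} (m : Matrix (Fin d) (Fin k) ℝ) (e : Fin k → Fin d)
    (he : (m.submatrix e id).det ≠ 0) :
    ∃ σ : Fin k ⊕ Fin (d - k) ≃ Fin d, ∀ a, σ (Sum.inl a) = e a := by
  have hinj : Function.Injective e := by
    intro a b hab
    by_contra hne
    exact he (Matrix.det_zero_of_row_eq hne (by ext; simp [hab]))
  have hc : Fintype.card {i // i ∉ Set.range e} = d - k := by
    classical
    rw [Fintype.card_subtype_compl]
    have : Fintype.card {i // i ∈ Set.range e} = k := by
      rw [← Fintype.card_congr (Equiv.ofInjective e hinj)]; simp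
    rw [this, Fintype.card_fin]
  classical
  let τ := (Fintype.equivFinOfCardEq hc).symm
  exact ⟨(Equiv.sumCongr (Equiv.ofInjective e hinj) τ).trans
    (Equiv.sumCompl (fun i => i ∈ Set.range e)), fun a => by simp⟩

theorem statement4 (d : ℕ) (l : Fin d → (Fin d → ℝ))
    (hl : LinearIndependent ℝ l) (ε : ℝ) (hε : 0 < ε)
    (c : (Fin d → ℝ) → ℝ)
    (hc : ∀ v, c v = ∏ j, (1 + |∑ i, l j i * v i|) ^ (-(1 + ε)))
    (k : ℕ) (hk : k ≤ d)
    (u : (Fin k → ℝ) →ₗ[ℝ] (Fin d → ℝ)) (hu : Function.Injective u) :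
    ∃ κ > (0 : ℝ), ∃ (N : ℕ) (la : Fin N → Fin (d - k) → (Fin d → ℝ)),
      -- each `(l_{α,1}, …, l_{α,d'})` is a basis of `(V/U)^∨`, i.e. a
      -- linearly independent `d'`-tuple of forms vanishing on `U`
      (∀ α, LinearIndependent ℝ (la α)) ∧
      (∀ α j, ∀ w : Fin k → ℝ, (∑ i, la α j i * u w i) = 0) ∧
      ∀ v : Fin d → ℝ,
        (∫ w : Fin k → ℝ, c (v + u w)) ≤
          κ * ∑ α, ∏ j, (1 + |∑ i, la α j i * v i|) ^ (-(1 + ε)) := by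
  classical
  let m : Matrix (Fin d) (Fin k) ℝ := Matrix.of l * LinearMap.toMatrix' u
  have hmw : ∀ w j, m.mulVec w j = ∑ i, l j i * u w i := by
    intro w j
    have : m.mulVec w = (Matrix.of l).mulVec (u w) := by
      rw [← Matrix.mulVec_mulVec, LinearMap.toMatrix'_mulVec]
    rw [this]; rfl
  have hlu : IsUnit (Matrix.of l) := Matrix.linearIndependent_rows_iff_isUnit.1 hl
  have hminj : Function.Injective m.mulVec := by
    have h1 := Matrix.mulVec_injective_of_isUnit hlu
    intro w w' h
    apply hu
    apply h1
    simpa only [m, ← Matrix.mulVec_mulVec, LinearMap.toMatrix'_mulVec] using h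
  have hex := aux_exists m hminj
  let S := {e : Fin k → Fin d // (m.submatrix e id).det ≠ 0}
  choose σ hσ using fun e : S => aux_equiv m e.1 e.2
  choose C hC0 hC using fun e : S => aux_int (m.submatrix e.1 id) e.2 ε hε
  let b : S → Fin d → Fin k → ℝ := fun e i => Matrix.vecMul (m i) (m.submatrix e.1 id)⁻¹
  let lb : S → Fin (d - k) → (Fin d → ℝ) := fun e j =>
    l (σ e (Sum.inr j)) - ∑ a, b e (σ e (Sum.inr j)) a • l (e.1 a)
  have hlb : ∀ e j (v : Fin d → ℝ), ∑ i, lb e j i * v i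
      = (∑ i, l (σ e (Sum.inr j)) i * v i)
        - ∑ a, b e (σ e (Sum.inr j)) a * ∑ i, l (e.1 a) i * v i := by
    intro e j v
    simp only [lb, Pi.sub_apply, Finset.sum_apply, Pi.smul_apply, smul_eq_mul, sub_mul,
      Finset.sum_sub_distrib, Finset.sum_mul, Finset.mul_sum]
    congr 1
    rw [Finset.sum_comm]
    simp only [mul_assoc]
  have hvan : ∀ e j (w : Fin k → ℝ), ∑ i, lb e j i * u w i = 0 := by
    intro e j w
    rw [hlb]
    simp only [← hmw]
    have h1 : Matrix.vecMul (b e (σ e (Sum.inr j))) (m.submatrix e.1 id)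
        = m (σ e (Sum.inr j)) := by
      simp only [b]
      rw [Matrix.vecMul_vecMul, Matrix.nonsing_inv_mul _ (isUnit_iff_ne_zero.2 e.2),
        Matrix.vecMul_one]
    have h2 : ∑ a, b e (σ e (Sum.inr j)) a * m.mulVec w (e.1 a)
        = b e (σ e (Sum.inr j)) ⬝ᵥ (m.submatrix e.1 id).mulVec w := rfl
    rw [h2, Matrix.dotProduct_mulVec, h1]
    exact sub_self _
  have hind : ∀ e, LinearIndependent ℝ (lb e) := by
    intro e
    let B := basisOfLinearIndependentOfCardEqFinrank' l hl (by simp)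
    have hB : ∀ i, l i = B i := fun i => by simp [B]
    let φ : (Fin d → ℝ) →ₗ[ℝ] (Fin (d - k) → ℝ) :=
      LinearMap.pi fun j => B.coord (σ e (Sum.inr j))
    apply LinearIndependent.of_comp φ
    have : φ ∘ lb e = fun j => Pi.single j (1 : ℝ) := by
      funext j
      ext j'
      simp only [Function.comp, φ, LinearMap.pi_apply, lb, map_sub, map_sum, map_smul, hB,
        Module.Basis.coord_apply, Module.Basis.repr_self, ← hσ e, Finsupp.single_apply, (σ e).injective.eq_iff]
      simp [Pi.single_apply, eq_comm]
    rw [this]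
    exact Pi.linearIndependent_single_one _ _
  let s := -(1 + ε)
  let K : ℝ := ((k + 1 : ℝ) ^ (-s)) ^ (d - k)
  have hK : 0 ≤ K := by positivity
  let P : S → (Fin d → ℝ) → ℝ := fun e v => ∏ j, (1 + |∑ i, lb e j i * v i|) ^ s
  have hP : ∀ e v, 0 ≤ P e v := fun e v => Finset.prod_nonneg fun j _ => by positivity
  let G : S → (Fin d → ℝ) → (Fin k → ℝ) → ℝ := fun e v w =>
    ∏ a, (1 + |(∑ i, l (e.1 a) i * v i) + (m.submatrix e.1 id).mulVec w a|) ^ s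
  have hG : ∀ e v w, 0 ≤ G e v w := fun e v w => Finset.prod_nonneg fun j _ => by positivity
  have hpt : ∀ v w, c (v + u w) ≤ ∑ e, K * P e v * G e v w := by
    intro v w
    let x : Fin d → ℝ := fun j => ∑ i, l j i * (v + u w) i
    obtain ⟨e, he, hxe⟩ := aux_key m hex x
    let E : S := ⟨e, he⟩
    have hle : c (v + u w) ≤ K * P E v * G E v w := by
      rw [hc, ← (σ E).prod_comp, Fintype.prod_sum_type, mul_comm]
      have hGe : G E v w = ∏ a, (1 + |∑ i, l (σ E (Sum.inl a)) i * (v + u w) i|) ^ (-(1 + ε)) := by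
        refine Finset.prod_congr rfl fun a _ => ?_
        have : (m.submatrix E.1 id).mulVec w a = m.mulVec w (e a) := rfl
        rw [this, hmw, hσ, ← Finset.sum_add_distrib]
        simp only [Pi.add_apply, mul_add, E, s]
      rw [← hGe]
      refine mul_le_mul_of_nonneg_right ?_ (hG _ _ _)
      have hKP : K * P E v
          = ∏ j, ((k + 1 : ℝ) ^ (-s) * (1 + |∑ i, lb E j i * v i|) ^ s) := by
        rw [Finset.prod_mul_distrib]; simp [K, P]
      rw [hKP]
      refine Finset.prod_le_prod (fun j _ => by positivity) fun j _ => ?_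
      have h1 := hxe (σ E (Sum.inr j))
      have h2 : ∑ i, lb E j i * v i = x (σ E (Sum.inr j))
          - ∑ a, (Matrix.vecMul (m (σ E (Sum.inr j))) (m.submatrix e id)⁻¹) a * x (e a) := by
        have h3 := hlb E j (v + u w)
        have h4 := hvan E j w
        have h5 : ∑ i, lb E j i * (v + u w) i = ∑ i, lb E j i * v i := by
          simp only [Pi.add_apply, mul_add, Finset.sum_add_distrib, h4, add_zero]
        rw [← h5, h3]
      rw [← h2] at h1
      have hk1 : (0 : ℝ) < k + 1 := by positivity
      have h6 : ((k + 1 : ℝ) * (1 + |x (σ E (Sum.inr j))|)) ^ s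
          ≤ (1 + |∑ i, lb E j i * v i|) ^ s :=
        Real.rpow_le_rpow_of_nonpos (by positivity) h1 (by simp only [s]; linarith)
      rw [Real.mul_rpow hk1.le (by positivity)] at h6
      have h7 := mul_le_mul_of_nonneg_left h6 (Real.rpow_nonneg hk1.le (-s))
      rw [← mul_assoc, ← Real.rpow_add hk1, neg_add_cancel, Real.rpow_zero, one_mul] at h7
      exact h7
    refine hle.trans ?_
    exact Finset.single_le_sum (f := fun e => K * P e v * G e v w)
      (fun e _ => mul_nonneg (mul_nonneg hK (hP _ _)) (hG _ _ _)) (Finset.mem_univ E)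
  have hCs : 0 ≤ ∑ e, C e := Finset.sum_nonneg fun e _ => hC0 e
  let τ : Fin (Fintype.card S) ≃ S := (Fintype.equivFin S).symm
  refine ⟨1 + K * ∑ e, C e, by positivity, Fintype.card S, fun α => lb (τ α),
    fun α => hind _, fun α => hvan _, fun v => ?_⟩
  have hre : ∑ α, ∏ j, (1 + |∑ i, lb (τ α) j i * v i|) ^ (-(1 + ε)) = ∑ e, P e v :=
    τ.sum_comp (fun e => P e v)
  rw [hre]
  have hGi : ∀ e, Integrable (G e v) := fun e => (hC e _).1
  have hGC : ∀ e, ∫ w, G e v w = C e := fun e => (hC e (fun a => ∑ i, l (e.1 a) i * v i)).2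
  calc ∫ w, c (v + u w) ≤ ∫ w, ∑ e, K * P e v * G e v w := by
        apply integral_mono_of_nonneg
        · refine Filter.Eventually.of_forall fun w => ?_
          simp only [hc, Pi.zero_apply]
          exact Finset.prod_nonneg fun j _ => by positivity
        · exact integrable_finsetSum _ fun e _ => (hGi e).const_mul _
        · exact Filter.Eventually.of_forall fun w => hpt v w
    _ = ∑ e, K * P e v * C e := by
        rw [integral_finsetSum _ fun e _ => (hGi e).const_mul _]
        simp only [integral_const_mul, hGC]
    _ ≤ ∑ e, (1 + K * ∑ e, C e) * P e v := by
        refine Finset.sum_le_sum fun e _ => ?_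
        have h1 : C e ≤ ∑ e, C e :=
          Finset.single_le_sum (fun e _ => hC0 e) (Finset.mem_univ e)
        have h2 := mul_le_mul_of_nonneg_left h1 (mul_nonneg hK (hP e v))
        nlinarith [hP e v]
    _ = _ := (Finset.mul_sum _ _ _).symm
end

section
/- Let V be a d-dimensional real vector space, let (l_1, …, l_d) be a basis of the dual space V^∨, fix ε > 0, and define c : V → (0,∞) by c(v) = ∏_{j=1}^d (1 + |l_j(v)|)^{−(1+ε)}. Then for every linear subspace U ⊆ V with a chosen Lebesgue measure du and every v ∈ V, the function u ↦ c(v + u) is measurable on U and the integral c_U(v) = ∫_U c(v + u) du is finite. -/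
open MeasureTheory
open scoped BigOperators

theorem exists_sel {d k : ℕ} (m : Fin d → Module.Dual ℝ (Fin k → ℝ))
    (hm : ∀ w, (∀ j, m j w = 0) → w = 0) :
    ∃ b : Fin k → Fin d, Function.Injective b ∧ ∀ w, (∀ i, m (b i) w = 0) → w = 0 := by
  obtain ⟨κ, a, ha, hs, hli⟩ := exists_linearIndependent' ℝ m
  haveI : Finite κ := Finite.of_injective a ha
  haveI := Fintype.ofFinite κ
  have key : ∀ w, (∀ i, m (a i) w = 0) → w = 0 := by
    intro w hw
    apply hm
    intro j
    have h1 : m j ∈ Submodule.span ℝ (Set.range (m ∘ a)) := by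
      rw [hs]; exact Submodule.subset_span ⟨j, rfl⟩
    have h2 : Submodule.span ℝ (Set.range (m ∘ a)) ≤
        LinearMap.ker (LinearMap.applyₗ w : Module.Dual ℝ (Fin k → ℝ) →ₗ[ℝ] ℝ) := by
      rw [Submodule.span_le]
      rintro _ ⟨i, rfl⟩
      simpa using hw i
    simpa using h2 h1
  have c1 : Fintype.card κ ≤ k := by
    have := hli.fintype_card_le_finrank
    rwa [Subspace.dual_finrank_eq, Module.finrank_fin_fun] at this
  have c2 : k ≤ Fintype.card κ := by
    have := LinearMap.finrank_le_finrank_of_injective (f := LinearMap.pi (fun i => m (a i)))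
      (by
        rw [← LinearMap.ker_eq_bot, LinearMap.ker_eq_bot']
        intro w hw
        exact key w (fun i => congrFun hw i))
    simpa using this
  let e : Fin k ≃ κ := Fintype.equivOfCardEq (by simp; omega)
  refine ⟨a ∘ e, ha.comp e.injective, fun w hw => key w fun i => ?_⟩
  simpa using hw (e.symm i)

theorem statement5 (d : ℕ) (l : Fin d → (Fin d → ℝ))
    (hl : LinearIndependent ℝ l) (ε : ℝ) (hε : 0 < ε)
    (c : (Fin d → ℝ) → ℝ)
    (hc : ∀ v, c v = ∏ j, (1 + |∑ i, l j i * v i|) ^ (-(1 + ε)))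
    (k : ℕ) (hk : k ≤ d)
    (u : (Fin k → ℝ) →ₗ[ℝ] (Fin d → ℝ)) (hu : Function.Injective u)
    (v : Fin d → ℝ) :
    Measurable (fun w : Fin k → ℝ => c (v + u w)) ∧
    Integrable (fun w : Fin k → ℝ => c (v + u w)) := by
  have hum : Measurable u := u.continuous_of_finiteDimensional.measurable
  have hmeas : Measurable (fun w : Fin k → ℝ => c (v + u w)) := by
    have hcm : Measurable c := by
      have : c = fun v => ∏ j, (1 + |∑ i, l j i * v i|) ^ (-(1 + ε)) := funext hc
      rw [this]
      apply Finset.measurable_fun_prod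
      intro j _
      apply Measurable.pow_const
      exact (by fun_prop : Continuous fun v : Fin d → ℝ => 1 + |∑ i, l j i * v i|).measurable
    exact hcm.comp (hum.const_add v)
  refine ⟨hmeas, ?_⟩
  let L : (Fin d → ℝ) →ₗ[ℝ] (Fin d → ℝ) := Matrix.mulVecLin (Matrix.of l)
  have hLap : ∀ x j, L x j = ∑ i, l j i * x i := fun x j => rfl
  have hL : Function.Injective L := by
    have h1 : IsUnit (Matrix.of l) := Matrix.linearIndependent_rows_iff_isUnit.1 hl
    exact Matrix.mulVec_injective_iff_isUnit.2 h1
  let m : Fin d → Module.Dual ℝ (Fin k → ℝ) := fun j => (LinearMap.proj j) ∘ₗ L ∘ₗ u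
  obtain ⟨b, hb, hbw⟩ := exists_sel m (by
    intro w hw
    apply hu
    apply hL
    rw [map_zero, map_zero]
    exact funext hw)
  let E : (Fin k → ℝ) →ₗ[ℝ] (Fin k → ℝ) := LinearMap.pi (fun i => m (b i))
  have hE : Function.Injective E := by
    rw [← LinearMap.ker_eq_bot, LinearMap.ker_eq_bot']
    intro w hw
    exact hbw w (fun i => congrFun hw i)
  have hdet : LinearMap.det E ≠ 0 := by
    have : IsUnit E := (LinearMap.isUnit_iff_ker_eq_bot E).2 (LinearMap.ker_eq_bot.2 hE)
    exact ((LinearMap.isUnit_iff_isUnit_det E).1 this).ne_zero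
  have hEm : Measurable E := E.continuous_of_finiteDimensional.measurable
  let g : (Fin k → ℝ) → ℝ := fun x => ∏ i, (1 + ‖L v (b i) + x i‖) ^ (-(1 + ε))
  have hg : Integrable g := by
    apply Integrable.fintype_prod (f := fun i (t : ℝ) => (1 + ‖L v (b i) + t‖) ^ (-(1 + ε)))
    intro i
    have := integrable_one_add_norm (E := ℝ) (μ := volume) (r := 1 + ε) (by simp; exact hε)
    exact this.comp_add_left (L v (b i))
  have hgE : Integrable (fun w => g (E w)) := by
    have h1 : Integrable g (Measure.map E volume) := by
      rw [Real.map_linearMap_volume_pi_eq_smul_volume_pi hdet]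
      exact hg.smul_measure ENNReal.ofReal_ne_top
    exact h1.comp_measurable hEm
  refine hgE.mono' hmeas.aestronglyMeasurable (Filter.Eventually.of_forall fun w => ?_)
  have hnn : ∀ x : ℝ, 0 ≤ (1 + |x|) ^ (-(1 + ε)) := fun x => by positivity
  have hle : ∀ x : ℝ, (1 + |x|) ^ (-(1 + ε)) ≤ 1 := fun x =>
    Real.rpow_le_one_of_one_le_of_nonpos (by linarith [abs_nonneg x]) (by linarith)
  rw [hc, Real.norm_of_nonneg (Finset.prod_nonneg fun j _ => hnn _)]
  have e1 : g (E w) = ∏ j ∈ Finset.univ.image b, (1 + |∑ i, l j i * (v + u w) i|) ^ (-(1 + ε)) := by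
    rw [Finset.prod_image (fun x _ y _ h => hb h)]
    apply Finset.prod_congr rfl
    intro i _
    rw [← hLap, map_add]
    rfl
  rw [e1]
  exact Finset.prod_le_prod_of_subset_of_le_one (Finset.subset_univ _) (fun _ _ => hnn _) (fun _ _ _ => hle _)
end

section
/- Let V be a d-dimensional real vector space, let (l_1, …, l_d) be a basis of the dual space V^∨, fix ε > 0, and define c : V → (0,∞) by c(v) = ∏_{j=1}^d (1 + |l_j(v)|)^{−(1+ε)}. Let U ⊆ V be a linear subspace with a chosen Lebesgue measure du and set c_U(v) = ∫_U c(v + u) du. Then for every v ∈ V with v ∉ U, one has lim_{τ → +∞} c_U(τ v) = 0 and lim_{τ → −∞} c_U(τ v) = 0. -/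
open MeasureTheory Filter
open scoped BigOperators

theorem aux_choose (d k : ℕ) (M : (Fin k → ℝ) →ₗ[ℝ] (Fin d → ℝ)) (hM : Function.Injective M) :
    ∃ a : Fin k → Fin d, Function.Injective a ∧
      ∃ P : (Fin k → ℝ) →ₗ[ℝ] (Fin k → ℝ), (∀ w i, P w i = M w (a i)) ∧
        Function.Bijective P := by
  let m : Fin d → Module.Dual ℝ (Fin k → ℝ) := fun j => (LinearMap.proj j).comp M
  obtain ⟨κ, a, ha, hspan, hli⟩ := exists_linearIndependent' ℝ m
  haveI : Finite κ := Finite.of_injective a ha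
  haveI := Fintype.ofFinite κ
  let P : (Fin k → ℝ) →ₗ[ℝ] (κ → ℝ) := LinearMap.pi fun i => m (a i)
  have hPinj : Function.Injective P := by
    rw [injective_iff_map_eq_zero]
    intro w hw
    have h1 : Submodule.span ℝ (Set.range (m ∘ a)) ≤
        LinearMap.ker (LinearMap.applyₗ (R := ℝ) (M₂ := ℝ) w) := by
      rw [Submodule.span_le]
      rintro _ ⟨i, rfl⟩
      exact congrFun hw i
    apply (injective_iff_map_eq_zero M).1 hM
    funext j
    have h2 : m j ∈ Submodule.span ℝ (Set.range (m ∘ a)) := by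
      rw [hspan]; exact Submodule.subset_span ⟨j, rfl⟩
    exact h1 h2
  have c1 : Fintype.card κ ≤ k := by
    have := hli.fintype_card_le_finrank
    simpa [Subspace.dual_finrank_eq] using this
  have c2 : k ≤ Fintype.card κ := by
    have := LinearMap.finrank_le_finrank_of_injective hPinj
    simpa using this
  have e : Fin k ≃ κ := Fintype.equivOfCardEq (by simp; omega)
  let Q : (Fin k → ℝ) →ₗ[ℝ] (Fin k → ℝ) := LinearMap.pi fun i => m (a (e i))
  have hQ : Function.Injective Q := by
    intro x y hxy
    apply hPinj
    funext i
    have := congrFun hxy (e.symm i)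
    simpa [Q, P] using this
  exact ⟨a ∘ e, ha.comp e.injective, Q, fun w i => rfl, hQ, LinearMap.injective_iff_surjective.1 hQ⟩

theorem aux_int_s6 (k : ℕ) (ε : ℝ) (hε : 0 < ε) (P : (Fin k → ℝ) →ₗ[ℝ] (Fin k → ℝ))
    (hP : Function.Bijective P) :
    Integrable (fun w : Fin k → ℝ => ∏ i, (1 + |P w i|) ^ (-(1 + ε))) := by
  have h1 : Integrable (fun x : ℝ => (1 + |x|) ^ (-(1 + ε))) := by
    have := integrable_one_add_norm (E := ℝ) (μ := volume) (r := 1 + ε) (by simp [hε])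
    simpa using this
  have h2 : Integrable (fun y : Fin k → ℝ => ∏ i, (1 + |y i|) ^ (-(1 + ε))) :=
    Integrable.fintype_prod (f := fun _ x => (1 + |x|) ^ (-(1 + ε))) fun _ => h1
  have hdet : LinearMap.det P ≠ 0 := by
    have := LinearEquiv.isUnit_det' (LinearEquiv.ofBijective P hP)
    exact this.ne_zero
  have h3 : Integrable (fun y : Fin k → ℝ => ∏ i, (1 + |y i|) ^ (-(1 + ε)))
      (Measure.map P volume) := by
    rw [Measure.map_linearMap_addHaar_eq_smul_addHaar volume hdet]
    exact h2.smul_measure ENNReal.ofReal_ne_top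
  exact h3.comp_measurable P.continuous_of_finiteDimensional.measurable

theorem aux_main (d : ℕ) (l : Fin d → (Fin d → ℝ))
    (hl : LinearIndependent ℝ l) (ε : ℝ) (hε : 0 < ε)
    (c : (Fin d → ℝ) → ℝ)
    (hc : ∀ v, c v = ∏ j, (1 + |∑ i, l j i * v i|) ^ (-(1 + ε)))
    (k : ℕ)
    (u : (Fin k → ℝ) →ₗ[ℝ] (Fin d → ℝ)) (hu : Function.Injective u)
    (v : Fin d → ℝ) (hv : v ∉ LinearMap.range u) (F : Filter ℝ) [F.IsCountablyGenerated]
    (hF : Tendsto (fun τ : ℝ => |τ|) F atTop) :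
    Tendsto (fun τ : ℝ => ∫ w : Fin k → ℝ, c (τ • v + u w)) F (nhds 0) := by
  let L : (Fin d → ℝ) →ₗ[ℝ] (Fin d → ℝ) := Matrix.mulVecLin (Matrix.of l)
  have hL : ∀ x j, L x j = ∑ i, l j i * x i := fun x j => rfl
  have hLinj : Function.Injective L := by
    have : IsUnit (Matrix.of l) := Matrix.linearIndependent_rows_iff_isUnit.1 hl
    exact Matrix.mulVec_injective_iff_isUnit.2 this
  have hc' : ∀ x, c x = ∏ j, (1 + |L x j|) ^ (-(1 + ε)) := hc
  obtain ⟨a, ha, P, hPM, hP⟩ := aux_choose d k (L.comp u) (hLinj.comp hu)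
  obtain ⟨w₀, hw₀⟩ := hP.2 (fun i => L v (a i))
  set v' := v - u w₀ with hv'
  have hv'0 : v' ≠ 0 := by
    intro h
    exact hv ⟨w₀, (sub_eq_zero.1 h).symm⟩
  have hv'a : ∀ i, L v' (a i) = 0 := by
    intro i
    have h1 := congrFun hw₀ i
    rw [hPM] at h1
    simp only [hv', map_sub, Pi.sub_apply]
    simp only [LinearMap.comp_apply] at h1
    linarith
  have hshift : ∀ τ : ℝ, ∫ w : Fin k → ℝ, c (τ • v + u w) = ∫ w : Fin k → ℝ, c (τ • v' + u w) := by
    intro τ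
    rw [← integral_add_right_eq_self (fun w => c (τ • v' + u w)) (τ • w₀)]
    congr 1
    funext w
    congr 1
    simp only [hv', map_add, map_smul, smul_sub]
    abel
  simp_rw [hshift]
  have hb0 : ∀ t : ℝ, 0 ≤ (1 + |t|) ^ (-(1 + ε)) := fun t => by positivity
  have hb1 : ∀ t : ℝ, (1 + |t|) ^ (-(1 + ε)) ≤ 1 := fun t =>
    Real.rpow_le_one_of_one_le_of_nonpos (by linarith [abs_nonneg t]) (by linarith)
  have hcc : Continuous c := by
    have : c = fun x => ∏ j, (1 + |L x j|) ^ (-(1 + ε)) := funext hc'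
    rw [this]
    have hLc : Continuous L := L.continuous_of_finiteDimensional
    refine continuous_finset_prod _ fun j _ => ?_
    refine Continuous.rpow_const ?_ fun x => Or.inl ?_
    · exact continuous_const.add ((continuous_apply j).comp hLc).abs
    · positivity
  have huc : Continuous u := u.continuous_of_finiteDimensional
  have key := tendsto_integral_filter_of_dominated_convergence (μ := (volume : Measure (Fin k → ℝ)))
    (l := F) (F := fun (τ : ℝ) w => c (τ • v' + u w)) (f := fun _ => (0:ℝ))
    (fun w : Fin k → ℝ => ∏ i, (1 + |P w i|) ^ (-(1 + ε)))
    (Eventually.of_forall fun τ => (hcc.comp (continuous_const.add huc)).aestronglyMeasurable)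
    (Eventually.of_forall fun τ => Eventually.of_forall fun w => ?_)
    (aux_int_s6 k ε hε P hP) (Eventually.of_forall fun w => ?_)
  · simpa using key
  · rw [hc', Real.norm_of_nonneg (Finset.prod_nonneg fun j _ => hb0 _)]
    have h1 : ∏ i, (1 + |P w i|) ^ (-(1 + ε)) =
        ∏ j ∈ Finset.univ.image a, (1 + |L (τ • v' + u w) j|) ^ (-(1 + ε)) := by
      rw [Finset.prod_image ha.injOn]
      refine Finset.prod_congr rfl fun i _ => ?_
      rw [hPM]
      simp [hv'a]
    rw [h1]
    exact Finset.prod_le_prod_of_subset_of_le_one (Finset.subset_univ _) (fun _ _ => hb0 _)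
      (fun _ _ _ => hb1 _)
  · obtain ⟨j, hj⟩ : ∃ j, L v' j ≠ 0 := by
      by_contra! h
      exact hv'0 ((injective_iff_map_eq_zero L).1 hLinj _ (funext h))
    have hlim : Tendsto (fun τ : ℝ => (1 + |L (τ • v' + u w) j|) ^ (-(1 + ε))) F (nhds 0) := by
      refine (tendsto_rpow_neg_atTop (y := 1 + ε) (by linarith)).comp ?_
      have h2 : Tendsto (fun τ : ℝ => |τ| * |L v' j| + (-|L (u w) j|)) F atTop :=
        tendsto_atTop_add_const_right _ _ (hF.atTop_mul_const (abs_pos.2 hj))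
      refine tendsto_atTop_mono (fun τ => ?_) h2
      have h3 := abs_sub_abs_le_abs_add (τ * L v' j) (L (u w) j)
      rw [abs_mul] at h3
      simp only [map_add, map_smul, Pi.add_apply, Pi.smul_apply, smul_eq_mul]
      linarith
    refine squeeze_zero (fun τ => ?_) (fun τ => ?_) hlim
    · rw [hc']; exact Finset.prod_nonneg fun j _ => hb0 _
    · rw [hc', ← Finset.mul_prod_erase _ _ (Finset.mem_univ j)]
      exact mul_le_of_le_one_right (hb0 _) (Finset.prod_le_one (fun _ _ => hb0 _) fun _ _ => hb1 _)

theorem statement6 (d : ℕ) (l : Fin d → (Fin d → ℝ))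
    (hl : LinearIndependent ℝ l) (ε : ℝ) (hε : 0 < ε)
    (c : (Fin d → ℝ) → ℝ)
    (hc : ∀ v, c v = ∏ j, (1 + |∑ i, l j i * v i|) ^ (-(1 + ε)))
    (k : ℕ) (hk : k ≤ d)
    (u : (Fin k → ℝ) →ₗ[ℝ] (Fin d → ℝ)) (hu : Function.Injective u)
    (v : Fin d → ℝ) (hv : v ∉ LinearMap.range u) :
    Tendsto (fun τ : ℝ => ∫ w : Fin k → ℝ, c (τ • v + u w)) atTop (nhds 0) ∧
    Tendsto (fun τ : ℝ => ∫ w : Fin k → ℝ, c (τ • v + u w)) atBot (nhds 0) :=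
  ⟨aux_main d l hl ε hε c hc k u hu v hv atTop tendsto_abs_atTop_atTop,
   aux_main d l hl ε hε c hc k u hu v hv atBot tendsto_abs_atBot_atTop⟩
end

section
/- Let V be a d-dimensional real vector space, let (l_1, …, l_d) be a basis of the dual space V^∨, fix ε > 0, and define c : V → (0,∞) by c(v) = ∏_{j=1}^d (1 + |l_j(v)|)^{−(1+ε)}. Let W ⊆ V be a linear subspace with a chosen Lebesgue measure dw, and let Γ ⊂ W be a lattice of full rank in W. Then there exists a constant κ > 0 such that for all v ∈ V, Σ_{γ ∈ Γ} c(v + γ) ≤ κ · ∫_W c(v + w) dw; in particular the sum on the left converges. -/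
/-!
Statement 8.  `V` is a `d`-dimensional real vector space, realized as `ℝ^d`;
a basis `(l_1, …, l_d)` of `V^∨` is given by `d` linearly independent
coefficient vectors; `c(v) = ∏_j (1+|l_j(v)|)^{-(1+ε)}`.  A subspace `W ⊆ V`
together with a full-rank lattice `Γ ⊂ W` is realized as `W = range u` and
`Γ = u(ℤ^k)` for an injective linear map `u : ℝ^k → ℝ^d` (every such pair
arises this way), and the Lebesgue measure `dw` on `W` is the transport of the
standard Lebesgue measure of `ℝ^k` (any other choice only rescales the
right-hand side, which is absorbed in the constant `κ`).
-/

open MeasureTheory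
open scoped BigOperators

lemma s8_cube {k : ℕ} (g : (Fin k → ℝ) → ℝ) (hg0 : ∀ w, 0 ≤ g w) (hgi : Integrable g)
    (K : ℝ) (hK : 0 ≤ K)
    (h : ∀ (γ : Fin k → ℤ) (w : Fin k → ℝ), (∀ i, ⌊w i⌋ = γ i) →
      g (fun i => (γ i : ℝ)) ≤ K * g w) :
    Summable (fun γ : Fin k → ℤ => g (fun i => (γ i : ℝ))) ∧
      (∑' γ : Fin k → ℤ, g (fun i => (γ i : ℝ))) ≤ K * ∫ w, g w := by
  let Q : (Fin k → ℤ) → Set (Fin k → ℝ) := fun γ =>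
    Set.pi Set.univ (fun i => Set.Ico (γ i : ℝ) (γ i + 1))
  have hQmem : ∀ γ w, w ∈ Q γ ↔ ∀ i, ⌊w i⌋ = γ i := by
    intro γ w
    simp only [Q, Set.mem_pi, Set.mem_univ, true_imp_iff, Set.mem_Ico, Int.floor_eq_iff]
  have hQm : ∀ γ, MeasurableSet (Q γ) := fun γ =>
    MeasurableSet.univ_pi (fun i => measurableSet_Ico)
  have hQv : ∀ γ, volume (Q γ) = 1 := by
    intro γ
    simp [Q, volume_pi, Measure.pi_pi]
  have hsum : ∀ s : Finset (Fin k → ℤ),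
      ∑ γ ∈ s, g (fun i => (γ i : ℝ)) ≤ K * ∫ w, g w := by
    intro s
    calc ∑ γ ∈ s, g (fun i => (γ i : ℝ)) ≤ ∑ γ ∈ s, ∫ w in Q γ, K * g w := by
          refine Finset.sum_le_sum (fun γ _ => ?_)
          have h1 : g (fun i => (γ i : ℝ)) = ∫ w in Q γ, g (fun i => (γ i : ℝ)) := by
            simp [Measure.real, hQv]
          rw [h1]
          refine setIntegral_mono_on ?_ ((hgi.const_mul K).integrableOn) (hQm γ) ?_
          · exact integrableOn_const (by simp [hQv])
          · intro w hw
            exact h γ w ((hQmem γ w).1 hw)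
      _ = ∫ w in ⋃ γ ∈ s, Q γ, K * g w := by
          rw [integral_biUnion_finset s (fun γ _ => hQm γ)]
          · intro γ _ γ' _ hne
            refine Set.disjoint_left.2 (fun w hw hw' => hne ?_)
            rw [hQmem] at hw hw'
            funext i
            rw [← hw i, hw' i]
          · intro γ _
            exact (hgi.const_mul K).integrableOn
      _ ≤ ∫ w, K * g w :=
          setIntegral_le_integral (hgi.const_mul K)
            (Filter.Eventually.of_forall fun w => mul_nonneg hK (hg0 w))
      _ = K * ∫ w, g w := integral_const_mul _ _
  exact ⟨summable_of_sum_le (fun _ => hg0 _) hsum, Real.tsum_le_of_sum_le (fun _ => hg0 _) hsum⟩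

lemma s8_int {k : ℕ} (A : (Fin k → ℝ) →ₗ[ℝ] (Fin k → ℝ)) (hA : Function.Injective A)
    (ε : ℝ) (hε : 0 < ε) (a : Fin k → ℝ) :
    Integrable (fun w : Fin k → ℝ => ∏ i, (1 + |a i + A w i|) ^ (-(1 + ε))) := by
  have h1 : ∀ b : ℝ, Integrable (fun x : ℝ => (1 + |b + x|) ^ (-(1 + ε))) := by
    intro b
    have : Integrable (fun x : ℝ => (1 + ‖x‖) ^ (-(1 + ε))) :=
      integrable_one_add_norm (by simp [hε])
    exact this.comp_add_left b
  have h2 : Integrable (fun y : Fin k → ℝ => ∏ i, (1 + |a i + y i|) ^ (-(1 + ε))) :=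
    Integrable.fintype_prod (f := fun i (x : ℝ) => (1 + |a i + x|) ^ (-(1 + ε)))
      (fun i => h1 (a i))
  have hdet : LinearMap.det A ≠ 0 := by
    intro h0
    have := LinearMap.bot_lt_ker_of_det_eq_zero h0
    rw [LinearMap.ker_eq_bot.2 hA] at this
    exact lt_irrefl _ this
  have hm := Measure.map_linearMap_addHaar_eq_smul_addHaar
    (volume : Measure (Fin k → ℝ)) hdet
  have h3 : Integrable (fun y : Fin k → ℝ => ∏ i, (1 + |a i + y i|) ^ (-(1 + ε)))
      (Measure.map A volume) := by
    rw [hm]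
    exact h2.smul_measure ENNReal.ofReal_ne_top
  exact h3.comp_measurable (LinearMap.continuous_of_finiteDimensional A).measurable

lemma s8_select {d k : ℕ} (f : Fin d → Module.Dual ℝ (Fin k → ℝ))
    (hf : ∀ w, (∀ j, f j w = 0) → w = 0) :
    ∃ σ : Fin k → Fin d, Function.Injective σ ∧
      Function.Injective (LinearMap.pi (fun i => f (σ i))) := by
  obtain ⟨g, hgm, hgs, hgl⟩ := Submodule.exists_fun_fin_finrank_span_eq ℝ (Set.range f)
  generalize hm : Module.finrank ℝ (Submodule.span ℝ (Set.range f)) = m at g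
  have hinj : Function.Injective (LinearMap.pi g) := by
    rw [← LinearMap.ker_eq_bot, LinearMap.ker_eq_bot']
    intro w hw
    apply hf
    intro j
    have hj : f j ∈ Submodule.span ℝ (Set.range g) := by
      rw [hgs]; exact Submodule.subset_span ⟨j, rfl⟩
    refine Submodule.span_induction (p := fun x _ => x w = 0) ?_ ?_ ?_ ?_ hj
    · rintro _ ⟨i, rfl⟩
      exact congrFun hw i
    · simp
    · intro x y _ _ hx hy; simp [hx, hy]
    · intro r x _ hx; simp [hx]
  have hmk : m = k := by
    apply le_antisymm
    · have := hgl.fintype_card_le_finrank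
      rw [Subspace.dual_finrank_eq] at this
      simpa using this
    · simpa using LinearMap.finrank_le_finrank_of_injective hinj
  clear hm
  subst hmk
  choose σ hσ using hgm
  have hσ' : (fun i => f (σ i)) = g := funext hσ
  refine ⟨σ, ?_, by rw [hσ']; exact hinj⟩
  intro i j hij
  apply hgl.injective
  rw [← hσ, ← hσ, hij]

theorem statement8 (d : ℕ) (l : Fin d → (Fin d → ℝ))
    (hl : LinearIndependent ℝ l) (ε : ℝ) (hε : 0 < ε)
    (c : (Fin d → ℝ) → ℝ)
    (hc : ∀ v, c v = ∏ j, (1 + |∑ i, l j i * v i|) ^ (-(1 + ε)))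
    (k : ℕ) (hk : k ≤ d)
    (u : (Fin k → ℝ) →ₗ[ℝ] (Fin d → ℝ)) (hu : Function.Injective u) :
    ∃ κ > (0 : ℝ), ∀ v : Fin d → ℝ,
      Summable (fun γ : Fin k → ℤ => c (v + u (fun i => (γ i : ℝ)))) ∧
      (∑' γ : Fin k → ℤ, c (v + u (fun i => (γ i : ℝ)))) ≤
        κ * ∫ w : Fin k → ℝ, c (v + u w) := by
  let L : Fin d → Module.Dual ℝ (Fin d → ℝ) := fun j =>
    (LinearMap.proj j).comp (Matrix.mulVecLin (Matrix.of l))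
  have hL : ∀ j v, ∑ i, l j i * v i = L j v := by
    intro j v
    simp [L, Matrix.mulVec, dotProduct]
  simp only [hL] at hc
  have hLinj : ∀ v, (∀ j, L j v = 0) → v = 0 := by
    intro v hv
    have hu : IsUnit (Matrix.of l) := Matrix.linearIndependent_rows_iff_isUnit.1 hl
    apply Matrix.mulVec_injective_iff_isUnit.2 hu
    rw [Matrix.mulVec_zero]
    funext j
    exact hv j
  let f : Fin d → Module.Dual ℝ (Fin k → ℝ) := fun j => (L j).comp u
  obtain ⟨σ, hσ, hA⟩ := s8_select f (fun w hw => by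
    apply hu
    rw [map_zero]
    exact hLinj _ hw)
  have hone : ∀ x : ℝ, 0 < 1 + |x| := fun x => by positivity
  have hc0 : ∀ v, 0 ≤ c v := by
    intro v
    rw [hc]
    exact Finset.prod_nonneg fun j _ => Real.rpow_nonneg (hone _).le _
  have hle1 : ∀ x : ℝ, (1 + |x|) ^ (-(1 + ε)) ≤ 1 := fun x =>
    Real.rpow_le_one_of_one_le_of_nonpos (by linarith [abs_nonneg x]) (by linarith)
  have hcont : ∀ v, Continuous (fun w : Fin k → ℝ => c (v + u w)) := by
    intro v
    have huc : Continuous u := LinearMap.continuous_of_finiteDimensional u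
    have hLc : ∀ j, Continuous (L j) := fun j => LinearMap.continuous_of_finiteDimensional _
    simp only [hc]
    refine continuous_finsetProd _ (fun j _ => ?_)
    refine Continuous.rpow_const ?_ (fun w => Or.inl (hone _).ne')
    exact continuous_const.add ((hLc j).comp (continuous_const.add huc)).abs
  have hint : ∀ v, Integrable (fun w : Fin k → ℝ => c (v + u w)) := by
    intro v
    refine (s8_int _ hA ε hε (fun i => L (σ i) v)).mono' (hcont v).aestronglyMeasurable ?_
    refine Filter.Eventually.of_forall (fun w => ?_)
    rw [Real.norm_of_nonneg (hc0 _), hc]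
    have e : ∏ i, (1 + |L (σ i) v + (LinearMap.pi (fun i => f (σ i))) w i|) ^ (-(1 + ε))
        = ∏ j ∈ Finset.univ.image σ, (1 + |L j (v + u w)|) ^ (-(1 + ε)) := by
      rw [Finset.prod_image (fun _ _ _ _ h => hσ h)]
      refine Finset.prod_congr rfl (fun i _ => ?_)
      rw [map_add]
      rfl
    rw [e]
    exact Finset.prod_le_prod_of_subset_of_le_one (Finset.subset_univ _)
      (fun j _ => Real.rpow_nonneg (hone _).le _) (fun j _ _ => hle1 _)
  -- uniform bound
  let B : Fin d → ℝ := fun j => ∑ i, |f j (Pi.single i 1)|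
  have hB0 : ∀ j, 0 ≤ B j := fun j => Finset.sum_nonneg fun i _ => abs_nonneg _
  have hB : ∀ j (t : Fin k → ℝ), (∀ i, |t i| ≤ 1) → |f j t| ≤ B j := by
    intro j t ht
    have : f j t = ∑ i, t i * f j (Pi.single i 1) := by
      conv_lhs => rw [pi_eq_sum_univ' t]
      simp [map_sum]
    rw [this]
    refine (Finset.abs_sum_le_sum_abs _ _).trans (Finset.sum_le_sum fun i _ => ?_)
    rw [abs_mul]
    exact mul_le_of_le_one_left (abs_nonneg _) (ht i)
  let K : ℝ := ∏ j, (1 + B j) ^ (1 + ε)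
  have hK : 0 < K := Finset.prod_pos fun j _ => Real.rpow_pos_of_pos (by linarith [hB0 j]) _
  refine ⟨K, hK, fun v => ?_⟩
  refine s8_cube (fun w => c (v + u w)) (fun w => hc0 _) (hint v) K hK.le ?_
  intro γ w hw
  simp only [hc, K]
  rw [← Finset.prod_mul_distrib]
  refine Finset.prod_le_prod (fun j _ => Real.rpow_nonneg (hone _).le _) (fun j _ => ?_)
  set γ' : Fin k → ℝ := fun i => (γ i : ℝ) with hγ'
  have hbd : |f j (w - γ')| ≤ B j := by
    apply hB
    intro i
    have h1 := Int.floor_le (w i)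
    have h2 := Int.lt_floor_add_one (w i)
    rw [hw i] at h1 h2
    simp only [Pi.sub_apply, hγ']
    rw [abs_le]
    constructor <;> linarith
  have hx : L j (v + u w) = L j (v + u γ') + f j (w - γ') := by
    simp only [f, LinearMap.comp_apply, map_add, map_sub]
    ring
  have hb : 1 + |L j (v + u w)| ≤ (1 + B j) * (1 + |L j (v + u γ')|) := by
    rw [hx]
    have := abs_add_le (L j (v + u γ')) (f j (w - γ'))
    nlinarith [mul_nonneg (hB0 j) (abs_nonneg (L j (v + u γ')))]
  have hBp : 0 < 1 + B j := by linarith [hB0 j]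
  have key := Real.rpow_le_rpow_of_nonpos (hone _) hb (show -(1 + ε) ≤ 0 by linarith)
  rw [Real.mul_rpow hBp.le (hone _).le, Real.rpow_neg hBp.le] at key
  rwa [inv_mul_le_iff₀ (Real.rpow_pos_of_pos hBp _)] at key
end

section
/- Let E be a finite-dimensional real vector space, and let l_1, …, l_m be linearly independent real linear forms on E. Set E^{(0)} = ∩_{j=1}^m ker(l_j) and E_0 = E/E^{(0)}, with canonical projection π_0 : E → E_0, and let E_0^+ = {x ∈ E_0 : l_j(x) ≥ 0 for 1 ≤ j ≤ m}, where the forms l_j are regarded as forms on E_0 (they vanish on E^{(0)}). Let V ⊆ E be a linear subspace with V ∩ E^{(0)} = {0} and π_0(V) ∩ E_0^+ = {0}, and let ψ_0 : E_0 → E_0/π_0(V) be the canonical projection. Then Λ = ψ_0(E_0^+) is a strictly convex polyhedral cone in E_0/π_0(V). -/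
/-!
Statement 9.  `E` is an abstract finite-dimensional real vector space,
`l_1, …, l_m` linearly independent linear forms, `E^{(0)} = ∩_j ker l_j`,
`E_0 = E/E^{(0)}` with projection `π_0`, `E_0^+ ⊆ E_0` the image under `π_0`
of `{x | l_j(x) ≥ 0 ∀ j}` (the forms `l_j` descend to `E_0`, so this is
`{x̄ | l_j(x̄) ≥ 0 ∀ j}`), `V ⊆ E` a subspace with `V ∩ E^{(0)} = 0` and
`π_0(V) ∩ E_0^+ = {0}`, and `ψ_0 : E_0 → E_0/π_0(V)` the projection.
Conclusion: `Λ = ψ_0(E_0^+)` is a strictly convex polyhedral cone, i.e. it is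
the set of nonnegative combinations of finitely many vectors and contains no
nonzero `x` with `-x` also in it.
-/

open scoped BigOperators

theorem statement9 (E : Type*) [AddCommGroup E] [Module ℝ E]
    [FiniteDimensional ℝ E]
    (m : ℕ) (l : Fin m → (E →ₗ[ℝ] ℝ)) (hl : LinearIndependent ℝ l)
    (V : Submodule ℝ E)
    -- `V ∩ E^{(0)} = {0}`
    (hV0 : V ⊓ (⨅ j, LinearMap.ker (l j)) = ⊥)
    -- `π_0(V) ∩ E_0^+ = {0}`
    (hVplus : ∀ y : E ⧸ (⨅ j, LinearMap.ker (l j)),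
      y ∈ V.map (⨅ j, LinearMap.ker (l j)).mkQ →
      y ∈ (⨅ j, LinearMap.ker (l j)).mkQ '' {x : E | ∀ j, 0 ≤ l j x} →
      y = 0) :
    -- `Λ = ψ_0(E_0^+)` is a polyhedral cone ...
    (∃ (N : ℕ) (gen : Fin N →
        (E ⧸ (⨅ j, LinearMap.ker (l j))) ⧸ V.map (⨅ j, LinearMap.ker (l j)).mkQ),
      ((V.map (⨅ j, LinearMap.ker (l j)).mkQ).mkQ ∘
          (⨅ j, LinearMap.ker (l j)).mkQ) '' {x : E | ∀ j, 0 ≤ l j x} =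
        {p | ∃ t : Fin N → ℝ, (∀ i, 0 ≤ t i) ∧ p = ∑ i, t i • gen i}) ∧
    -- ... which is strictly convex
    (∀ p ∈ ((V.map (⨅ j, LinearMap.ker (l j)).mkQ).mkQ ∘
          (⨅ j, LinearMap.ker (l j)).mkQ) '' {x : E | ∀ j, 0 ≤ l j x},
      -p ∈ ((V.map (⨅ j, LinearMap.ker (l j)).mkQ).mkQ ∘
          (⨅ j, LinearMap.ker (l j)).mkQ) '' {x : E | ∀ j, 0 ≤ l j x} →
      p = 0) := by
  have hdual : ∃ e : Fin m → E, ∀ i j, l j (e i) = if j = i then 1 else 0 := by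
    obtain ⟨g, hg⟩ := LinearMap.exists_leftInverse_of_injective
      (Finsupp.linearCombination ℝ l) (LinearMap.ker_eq_bot.2 hl)
    refine ⟨fun i => (Module.evalEquiv ℝ E).symm ((Finsupp.lapply i).comp g), fun i j => ?_⟩
    have h := LinearMap.congr_fun hg (Finsupp.single j 1)
    simp only [LinearMap.comp_apply, Finsupp.linearCombination_single, one_smul,
      LinearMap.id_apply] at h
    rw [Module.apply_evalEquiv_symm_apply]
    simp [h, Finsupp.single_apply]
  obtain ⟨e, he⟩ := hdual
  clear hV0
  have hmem : ∀ x : E, x ∈ (⨅ j, LinearMap.ker (l j)) ↔ ∀ j, l j x = 0 := by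
    intro x
    simp [Submodule.mem_iInf]
  generalize (⨅ j, LinearMap.ker (l j)) = K at *
  constructor
  · refine ⟨m, fun i => (V.map K.mkQ).mkQ (K.mkQ (e i)), ?_⟩
    have key : ∀ (t : Fin m → ℝ) (j), l j (∑ i, t i • e i) = t j := by
      intro t j
      simp [map_sum, he]
    ext p
    constructor
    · rintro ⟨x, hx, rfl⟩
      refine ⟨fun j => l j x, hx, ?_⟩
      have h0 : x - ∑ i, l i x • e i ∈ K := by
        rw [hmem]
        intro j
        rw [map_sub, key (fun i => l i x) j, sub_self]
      have h1 : K.mkQ x = K.mkQ (∑ i, l i x • e i) := (Submodule.Quotient.eq K).2 h0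
      simp only [Function.comp_apply]
      rw [h1]
      simp only [map_sum, map_smul]
    · rintro ⟨t, ht, rfl⟩
      refine ⟨∑ i, t i • e i, fun j => ?_, ?_⟩
      · rw [key]; exact ht j
      · simp only [Function.comp_apply, map_sum, map_smul]
  · rintro p ⟨x, hx, rfl⟩ ⟨y, hy, hxy⟩
    simp only [Function.comp_apply] at hxy ⊢
    have h1 : K.mkQ (x + y) ∈ V.map K.mkQ := by
      rw [← Submodule.ker_mkQ (V.map K.mkQ), LinearMap.mem_ker, map_add, map_add, hxy,
        add_neg_cancel]
    have h2 := hVplus _ h1 ⟨x + y, fun j => by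
      rw [map_add]; exact add_nonneg (hx j) (hy j), rfl⟩
    rw [← LinearMap.mem_ker, Submodule.ker_mkQ, hmem] at h2
    have h3 : x ∈ K := by
      rw [hmem]
      intro j
      have a := h2 j
      rw [map_add] at a
      have b := hx j
      have c := hy j
      linarith
    have h4 : K.mkQ x = 0 := by
      rw [← LinearMap.mem_ker, Submodule.ker_mkQ]; exact h3
    rw [h4, map_zero]
end
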